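/- arXiv:2507.13777 — 3 statements merged into one kernel-verified Lean document; each statement's English description precedes it below -/
import Mathlib

section
/- If G is a finite simple connected graph with n(G) ≥ ω(G)+1 ≥ 4, then dim_l(G) ≤ ⌊((ω(G)−2)/(ω(G)−1))·n(G)⌋. -/
open SimpleGraph

variable {V : Type*} [Fintype V] [DecidableEq V]

/-- `S` is a local resolving set of `G`. -/
def IsLocalResolving (G : SimpleGraph V) (S : Finset V) : Prop :=
  ∀ u v : V, G.Adj u v → u ∉ S → v ∉ S → ∃ w ∈ S, G.dist u w ≠ G.dist v w

/-- The local metric dimension of `G`. -/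
noncomputable def dimL (G : SimpleGraph V) : ℕ :=
  sInf {k | ∃ S : Finset V, S.card = k ∧ IsLocalResolving G S}

/-- `S` is a local adjacency resolving set of `G`. -/
def IsLocalAdjResolving (G : SimpleGraph V) (S : Finset V) : Prop :=
  ∀ u v : V, G.Adj u v → u ∉ S → v ∉ S → ∃ w ∈ S, Xor' (G.Adj w u) (G.Adj w v)

/-- The local adjacency metric dimension of `G`. -/
noncomputable def dimAL (G : SimpleGraph V) : ℕ :=
  sInf {k | ∃ S : Finset V, S.card = k ∧ IsLocalAdjResolving G S}

/-- `S` is a resolving set of `G`. -/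
def IsResolving (G : SimpleGraph V) (S : Finset V) : Prop :=
  ∀ u v : V, u ≠ v → u ∉ S → v ∉ S → ∃ w ∈ S, G.dist u w ≠ G.dist v w

/-- The metric dimension of `G`. -/
noncomputable def dimM (G : SimpleGraph V) : ℕ :=
  sInf {k | ∃ S : Finset V, S.card = k ∧ IsResolving G S}

/-- `S` is an adjacency resolving set of `G`. -/
def IsAdjResolving (G : SimpleGraph V) (S : Finset V) : Prop :=
  ∀ u v : V, u ≠ v → u ∉ S → v ∉ S → ∃ w ∈ S, Xor' (G.Adj w u) (G.Adj w v)

/-- The adjacency metric dimension of `G`. -/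
noncomputable def dimA (G : SimpleGraph V) : ℕ :=
  sInf {k | ∃ S : Finset V, S.card = k ∧ IsAdjResolving G S}

open Finset

/-- Any two adjacent vertices of `T` are told apart by the neighbourhood of a vertex outside `T`. -/
def OuterSeparated (G : SimpleGraph V) (T : Finset V) : Prop :=
  ∀ a ∈ T, ∀ b ∈ T, G.Adj a b → ∃ w, w ∉ T ∧ ¬(G.Adj w a ↔ G.Adj w b)

/-- `s` is the only vertex outside `T` that tells apart some edge of `T`. -/
def IsEssential (G : SimpleGraph V) (T : Finset V) (s : V) : Prop :=
  ∃ a ∈ T, ∃ b ∈ T, G.Adj a b ∧ G.Adj s a ∧ ¬G.Adj s b ∧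
    ∀ w, w ∉ T → w ≠ s → (G.Adj w a ↔ G.Adj w b)

open scoped Classical in
/-- The neighbours of `v` outside `T`. -/
noncomputable def outerNbrs (G : SimpleGraph V) (T : Finset V) (v : V) : Finset V :=
  univ.filter fun w => w ∉ T ∧ G.Adj v w

/-- `v ∈ T`, and its neighbours outside `T` form a `k`-clique that is a connected component of the
graph induced outside `T`. -/
def HasCliqueComponent (G : SimpleGraph V) (T : Finset V) (k : ℕ) (v : V) : Prop :=
  v ∈ T ∧ #(outerNbrs G T v) = k ∧
    (∀ a ∈ outerNbrs G T v, ∀ b ∈ outerNbrs G T v, a ≠ b → G.Adj a b) ∧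
    ∀ s ∈ outerNbrs G T v, ∀ w, w ∉ T → G.Adj s w → w ∈ outerNbrs G T v

/-- `F` is a `k`-clique component outside `T` made of inessential vertices, and `v` is the only
vertex of `T` whose inessential outer neighbourhood is `F`. -/
structure IsExcess (G : SimpleGraph V) (T : Finset V) (k : ℕ) (v : V) (F : Finset V) : Prop where
  mem : v ∈ T
  card_eq : #F = k
  notMem : ∀ f ∈ F, f ∉ T
  inessential : ∀ f ∈ F, ¬IsEssential G T f
  adj_iff : ∀ w, w ∉ T → (G.Adj v w ↔ w ∈ F)
  adj_iff_of_mem : ∀ f ∈ F, ∀ w, w ∉ T → (G.Adj f w ↔ w ∈ F ∧ w ≠ f)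
  unique : ∀ u ∈ T, (∀ w, w ∉ T → ¬IsEssential G T w → (G.Adj u w ↔ w ∈ F)) → u = v

section

variable {G : SimpleGraph V} {T F : Finset V} {k : ℕ} {v x f : V}

lemma mem_outerNbrs {w : V} : w ∈ outerNbrs G T v ↔ w ∉ T ∧ G.Adj v w := by
  simp [outerNbrs]

lemma notMem_insert_erase {w : V} :
    w ∉ insert f (T.erase x) ↔ w ≠ f ∧ (w ∉ T ∨ w = x) := by
  simp only [mem_insert, mem_erase]
  tauto

lemma OuterSeparated.exists_ne (hT : OuterSeparated G T) (hf : ¬IsEssential G T f) {a b : V}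
    (ha : a ∈ T) (hb : b ∈ T) (hab : G.Adj a b) :
    ∃ w, w ∉ T ∧ w ≠ f ∧ ¬(G.Adj w a ↔ G.Adj w b) := by
  by_contra! h
  obtain ⟨w, hw, hne⟩ := hT a ha b hb hab
  have hwf : w = f := by
    by_contra hwf
    exact hne (h w hw hwf)
  subst hwf
  by_cases h1 : G.Adj w a
  · exact hf ⟨a, ha, b, hb, hab, h1, fun h2 => hne (by tauto), h⟩
  · exact hf ⟨b, hb, a, ha, hab.symm, by tauto, h1, fun z hz hzw => (h z hz hzw).symm⟩

lemma IsExcess.outerSeparated_exchange (hT : OuterSeparated G T) (he : IsExcess G T k v F)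
    (hx : x ∈ T) (hf : f ∈ F) (hxf : ¬(G.Adj x f ↔ G.Adj x v)) :
    OuterSeparated G (insert f (T.erase x)) := by
  have hfT := he.notMem f hf
  have key : ∀ u ∈ T, u ≠ x → G.Adj f u →
      ∃ w, w ∉ insert f (T.erase x) ∧ ¬(G.Adj w f ↔ G.Adj w u) := by
    intro u hu hux hfu
    by_cases huv : u = v
    · subst huv
      exact ⟨x, notMem_insert_erase.2 ⟨by rintro rfl; exact hfT hx, Or.inr rfl⟩, hxf⟩
    · by_contra! h
      refine huv (he.unique u hu fun w hw _ => ?_)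
      by_cases hwf : w = f
      · subst hwf
        simp [hf, hfu.symm]
      · have h1 := h w (notMem_insert_erase.2 ⟨hwf, Or.inl hw⟩)
        have h2 := he.adj_iff_of_mem f hf w hw
        rw [G.adj_comm u w, ← h1, G.adj_comm w f, h2]
        tauto
  intro a ha b hb hab
  rw [mem_insert, mem_erase] at ha hb
  rcases ha with rfl | ⟨hax, ha⟩ <;> rcases hb with rfl | ⟨hbx, hb⟩
  · exact (G.loopless.irrefl _ hab).elim
  · exact key b hb hbx hab
  · obtain ⟨w, hw, hne⟩ := key a ha hax hab.symm
    exact ⟨w, hw, fun h => hne h.symm⟩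
  · obtain ⟨w, hw, hwf, hne⟩ := hT.exists_ne (he.inessential f hf) ha hb hab
    exact ⟨w, notMem_insert_erase.2 ⟨hwf, Or.inl hw⟩, hne⟩

lemma IsExcess.not_hasCliqueComponent_exchange (he : IsExcess G T k v F)
    (hx : x ∈ T) (hf : f ∈ F) (hxf : ¬(G.Adj x f ↔ G.Adj x v)) :
    ¬HasCliqueComponent G (insert f (T.erase x)) k v := by
  rintro ⟨hv, hcard, hclique, hclosed⟩
  have hfT := he.notMem f hf
  have hmem : ∀ w, w ∈ outerNbrs G (insert f (T.erase x)) v ↔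
      w ≠ f ∧ (w ∈ F ∨ w = x ∧ G.Adj x v) := by
    intro w
    rw [mem_outerNbrs, notMem_insert_erase]
    have h1 := he.adj_iff w
    have h2 := he.notMem w
    by_cases hwx : w = x
    · subst hwx
      have := G.adj_comm v w
      tauto
    · tauto
  by_cases hxv : G.Adj x v
  · have hxf' : ¬G.Adj x f := by tauto
    have hxF : x ≠ f := by rintro rfl; exact hfT hx
    have hxm : x ∈ outerNbrs G (insert f (T.erase x)) v := (hmem x).2 ⟨hxF, Or.inr ⟨rfl, hxv⟩⟩
    refine he.inessential f hf ⟨v, he.mem, x, hx, hxv.symm, ((he.adj_iff f hfT).2 hf).symm,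
      fun h => hxf' h.symm, fun w hw hwf => ?_⟩
    have hwx : w ≠ x := by rintro rfl; exact hw hx
    rw [G.adj_comm w v, he.adj_iff w hw]
    constructor
    · intro hwF
      exact hclique w ((hmem w).2 ⟨hwf, Or.inl hwF⟩) x hxm hwx
    · intro h
      have := hclosed x hxm w (notMem_insert_erase.2 ⟨hwf, Or.inl hw⟩) h.symm
      rw [hmem] at this
      tauto
  · have : outerNbrs G (insert f (T.erase x)) v = F.erase f := by
      ext w
      rw [hmem, mem_erase]
      tauto
    rw [this, card_erase_of_mem hf, he.card_eq] at hcard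
    have := he.card_eq ▸ card_pos.2 ⟨f, hf⟩
    omega

lemma IsExcess.hasCliqueComponent_exchange (hT : OuterSeparated G T) (he : IsExcess G T k v F)
    (hx : x ∈ T) (hxv : x ≠ v) (hf : f ∈ F) (hxf : ¬(G.Adj x f ↔ G.Adj x v)) {u : V}
    (hu : HasCliqueComponent G (insert f (T.erase x)) k u) :
    HasCliqueComponent G T k u ∨
      u ∈ T ∧ G.Adj u f ∧ (∀ g ∈ F, g ≠ f → ¬G.Adj u g) ∧ #((outerNbrs G T u).erase f) = k ∧
        ∀ a ∈ (outerNbrs G T u).erase f, ∀ b ∈ (outerNbrs G T u).erase f, a ≠ b → G.Adj a b := by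
  have hfT := he.notMem f hf
  have hxF : x ≠ f := by rintro rfl; exact hfT hx
  have hout : ∀ w, w ∉ insert f (T.erase x) ↔ w ≠ f ∧ (w ∉ T ∨ w = x) :=
    fun w => notMem_insert_erase
  have hmem : ∀ w, w ∈ outerNbrs G (insert f (T.erase x)) u ↔
      (w ≠ f ∧ (w ∉ T ∨ w = x)) ∧ G.Adj u w := by
    intro w
    rw [mem_outerNbrs, hout]
  obtain ⟨huT', hcard, hclique, hclosed⟩ := hu
  have hFcard : #(F.erase f) < k := by
    rw [← he.card_eq]
    exact card_erase_lt_of_mem hf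
  have huT : u ∈ T ∧ u ≠ x := by
    rcases mem_insert.1 huT' with rfl | h
    · exfalso
      by_cases hxu : G.Adj x u
      · have hxm := (hmem x).2 ⟨⟨hxF, Or.inr rfl⟩, hxu.symm⟩
        refine hxv (he.unique x hx fun w hw _ => ?_)
        by_cases hwu : w = u
        · subst hwu
          simp [hf, hxu]
        have hwx : w ≠ x := by rintro rfl; exact hw hx
        constructor
        · intro h
          have := (hmem w).1 (hclosed x hxm w ((hout w).2 ⟨hwu, Or.inl hw⟩) h)
          exact ((he.adj_iff_of_mem u hf w hw).1 this.2).1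
        · intro h
          exact hclique x hxm w ((hmem w).2 ⟨⟨hwu, Or.inl hw⟩,
            (he.adj_iff_of_mem u hf w hw).2 ⟨h, hwu⟩⟩) hwx.symm
      · refine absurd hcard (ne_of_lt (lt_of_le_of_lt (card_le_card fun w hw => ?_) hFcard))
        obtain ⟨⟨hwf, hw | rfl⟩, h⟩ := (hmem w).1 hw
        · exact mem_erase.2 ⟨hwf, ((he.adj_iff_of_mem u hf w hw).1 h).1⟩
        · exact absurd h.symm hxu
    · exact ⟨(mem_erase.1 h).2, (mem_erase.1 h).1⟩
  obtain ⟨huT, hux⟩ := huT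
  have hxu : ¬G.Adj x u := by
    intro hxu
    have hxm := (hmem x).2 ⟨⟨hxF, Or.inr rfl⟩, hxu.symm⟩
    obtain ⟨w, hw, hwf, hne⟩ := hT.exists_ne (he.inessential f hf) hx huT hxu
    have hwx : w ≠ x := by rintro rfl; exact hw hx
    refine hne ⟨fun h => ?_, fun h => ?_⟩
    · exact ((hmem w).1 (hclosed x hxm w ((hout w).2 ⟨hwf, Or.inl hw⟩) h.symm)).2.symm
    · exact hclique w ((hmem w).2 ⟨⟨hwf, Or.inl hw⟩, h.symm⟩) x hxm hwx
  have herase : outerNbrs G (insert f (T.erase x)) u = (outerNbrs G T u).erase f := by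
    ext w
    rw [hmem, mem_erase, mem_outerNbrs]
    by_cases hwx : w = x
    · subst hwx
      have := G.adj_comm w u
      tauto
    · tauto
  rw [herase] at hcard hclique hclosed
  have hdisj : ∀ g ∈ F, g ∉ (outerNbrs G T u).erase f := by
    intro g hg hgu
    refine absurd hcard (ne_of_lt (lt_of_le_of_lt (card_le_card fun w hw => ?_) hFcard))
    have hw' := mem_erase.1 hw
    refine mem_erase.2 ⟨hw'.1, ?_⟩
    by_cases hgw : g = w
    · exact hgw ▸ hg
    · exact ((he.adj_iff_of_mem g hg w (mem_outerNbrs.1 hw'.2).1).1 (hclique g hgu w hw hgw)).1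
  by_cases huf : G.Adj u f
  · refine Or.inr ⟨huT, huf, fun g hg hgf h => ?_, hcard, hclique⟩
    exact hdisj g hg (mem_erase.2 ⟨hgf, mem_outerNbrs.2 ⟨he.notMem g hg, h⟩⟩)
  · have heq : (outerNbrs G T u).erase f = outerNbrs G T u :=
      erase_eq_of_notMem fun h => huf (mem_outerNbrs.1 h).2
    rw [heq] at hcard hclique hclosed hdisj
    refine Or.inl ⟨huT, hcard, hclique, fun s hs w hw hsw => ?_⟩
    refine hclosed s hs w ((hout w).2 ⟨?_, Or.inl hw⟩) hsw
    rintro rfl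
    have hs' := (mem_outerNbrs.1 hs).1
    exact hdisj s ((he.adj_iff_of_mem w hf s hs').1 hsw.symm).1 hs

lemma IsExcess.isClique_insert (he : IsExcess G T k v F) :
    G.IsClique (insert v F : Finset V) := by
  have hF : G.IsClique (F : Set V) := fun a ha b hb hab =>
    (he.adj_iff_of_mem a ha b (he.notMem b hb)).2 ⟨hb, hab.symm⟩
  rw [coe_insert]
  exact hF.insert fun b hb _ => (he.adj_iff b (he.notMem b hb)).2 hb

lemma IsExcess.exists_exchange (hc : G.Connected) (hω : G.cliqueNum = k + 1)
    (hn : k + 2 ≤ Fintype.card V) (he : IsExcess G T k v F) :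
    ∃ x ∈ T, x ≠ v ∧ ∃ f ∈ F, ¬(G.Adj x f ↔ G.Adj x v) := by
  have hvF : v ∉ F := fun h => he.notMem v h he.mem
  have hcard : #(insert v F) = k + 1 := by rw [card_insert_of_notMem hvF, he.card_eq]
  obtain ⟨z, hz⟩ : ∃ z, z ∉ insert v F := by
    by_contra! h
    have : insert v F = univ := eq_univ_iff_forall.2 h
    rw [this, card_univ] at hcard
    omega
  obtain ⟨p⟩ := hc.preconnected v z
  obtain ⟨d, -, hd1, hd2⟩ := p.exists_boundary_dart (↑(insert v F)) (by simp) (by simpa using hz)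
  have hd := d.adj
  set y := d.fst
  set x := d.snd
  rw [mem_coe] at hd1 hd2
  have hxT : x ∈ T := by
    by_contra hx
    rcases mem_insert.1 hd1 with h | h
    · rw [h] at hd
      exact hd2 (mem_insert_of_mem ((he.adj_iff x hx).1 hd))
    · exact hd2 (mem_insert_of_mem ((he.adj_iff_of_mem y h x hx).1 hd).1)
  refine ⟨x, hxT, fun h => hd2 (h ▸ mem_insert_self _ _), ?_⟩
  by_contra! h
  have hxv : G.Adj x v := by
    rcases mem_insert.1 hd1 with hy | hy
    · exact hy ▸ hd.symm
    · exact (h y hy).1 hd.symm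
  have hcl : G.IsClique (insert x (insert v F) : Finset V) := by
    rw [coe_insert]
    refine he.isClique_insert.insert fun b hb _ => ?_
    rcases mem_insert.1 (mem_coe.1 hb) with rfl | hb
    · exact hxv
    · exact (h b hb).2 hxv
  have := hcl.card_le_cliqueNum
  rw [card_insert_of_notMem hd2] at this
  omega

lemma OuterSeparated.exists_twin (hT : OuterSeparated G T)
    (hmax : ∀ T', OuterSeparated G T' → #T' ≤ #T) {s : V} (hs : s ∉ T)
    (hess : ¬IsEssential G T s) :
    ∃ u ∈ T, G.Adj s u ∧ ∀ w, w ∉ T → w ≠ s → (G.Adj w s ↔ G.Adj w u) := by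
  have hnot : ¬OuterSeparated G (insert s T) := fun h => by
    have := hmax _ h
    rw [card_insert_of_notMem hs] at this
    omega
  simp only [OuterSeparated] at hnot
  push Not at hnot
  obtain ⟨a, ha, b, hb, hab, h⟩ := hnot
  have h' : ∀ w, w ∉ T → w ≠ s → (G.Adj w a ↔ G.Adj w b) := fun w hw hws =>
    h w (by simp [hw, hws])
  rw [mem_insert] at ha hb
  rcases ha with rfl | ha <;> rcases hb with rfl | hb
  · exact (G.loopless.irrefl _ hab).elim
  · exact ⟨b, hb, hab, h'⟩
  · exact ⟨a, ha, hab.symm, fun w hw hws => (h' w hw hws).symm⟩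
  · obtain ⟨w, hw, hws, hne⟩ := hT.exists_ne hess ha hb hab
    exact (hne (h' w hw hws)).elim

open scoped Classical in
lemma IsExcess.exists_attached (hc : G.Connected) (hω : G.cliqueNum = k + 1)
    (hn : k + 2 ≤ Fintype.card V) (hT : OuterSeparated G T)
    (hmin : ∀ T', OuterSeparated G T' → #T' = #T →
      #(univ.filter (HasCliqueComponent G T k)) ≤ #(univ.filter (HasCliqueComponent G T' k)))
    (he : IsExcess G T k v F) :
    ∃ u ∈ T, u ≠ v ∧ ∃ f ∈ F, G.Adj u f ∧ (∀ g ∈ F, g ≠ f → ¬G.Adj u g) ∧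
      #((outerNbrs G T u).erase f) = k ∧
      ∀ a ∈ (outerNbrs G T u).erase f, ∀ b ∈ (outerNbrs G T u).erase f, a ≠ b → G.Adj a b := by
  obtain ⟨x, hx, hxv, f, hf, hxf⟩ := he.exists_exchange hc hω hn
  have hfT := he.notMem f hf
  have hv : HasCliqueComponent G T k v := by
    have hout : outerNbrs G T v = F := by
      ext w
      rw [mem_outerNbrs]
      exact ⟨fun h => (he.adj_iff w h.1).1 h.2,
        fun h => ⟨he.notMem w h, (he.adj_iff w (he.notMem w h)).2 h⟩⟩
    refine ⟨he.mem, ?_⟩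
    rw [hout]
    exact ⟨he.card_eq, fun a ha b hb hab =>
      (he.adj_iff_of_mem a ha b (he.notMem b hb)).2 ⟨hb, hab.symm⟩,
      fun s hs w hw h => ((he.adj_iff_of_mem s hs w hw).1 h).1⟩
  have hcard : #(insert f (T.erase x)) = #T := by
    rw [card_insert_of_notMem (fun h => hfT (mem_of_mem_erase h)), card_erase_add_one hx]
  have hle := hmin _ (he.outerSeparated_exchange hT hx hf hxf) hcard
  have hv' := he.not_hasCliqueComponent_exchange hx hf hxf
  obtain ⟨u, hu, hu'⟩ : ∃ u, HasCliqueComponent G (insert f (T.erase x)) k u ∧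
      ¬HasCliqueComponent G T k u := by
    by_contra! h
    refine absurd hle (not_le.2 (card_lt_card ?_))
    refine (ssubset_iff_of_subset fun w hw => ?_).2 ⟨v, ?_, ?_⟩
    · simp only [mem_filter, mem_univ, true_and] at hw ⊢
      exact h w hw
    · simpa using hv
    · simpa using hv'
  obtain ⟨huT, huf, h⟩ := (he.hasCliqueComponent_exchange hT hx hxv hf hxf hu).resolve_left hu'
  exact ⟨u, huT, fun h => hu' (h ▸ hv), f, hf, huf, h⟩

end

/-- A family of sets containing, for each `s ∈ L`, two members differing exactly in `s` has more
members than `L`. -/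
lemma card_lt_of_forall_insert_mem {α : Type*} [DecidableEq α] (L : Finset α) :
    ∀ 𝒯 : Finset (Finset α), 𝒯.Nonempty → (∀ s ∈ L, ∃ A ∈ 𝒯, s ∉ A ∧ insert s A ∈ 𝒯) →
      #L < #𝒯 := by
  induction L using Finset.induction_on with
  | empty => intro 𝒯 h _; simpa using h
  | insert s L hs ih =>
    intro 𝒯 hne h
    have h1 : #L < #(𝒯.image fun A => A.erase s) := by
      refine ih _ (hne.image _) fun r hr => ?_
      obtain ⟨A, hA, hrA, hAr⟩ := h r (mem_insert_of_mem hr)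
      have hrs : r ≠ s := by rintro rfl; exact hs hr
      refine ⟨A.erase s, mem_image_of_mem _ hA, fun h => hrA (mem_of_mem_erase h), ?_⟩
      rw [← erase_insert_of_ne hrs]
      exact mem_image_of_mem (fun A => A.erase s) hAr
    have h2 : #(𝒯.image fun A => A.erase s) < #𝒯 := by
      refine lt_of_le_of_ne card_image_le fun heq => ?_
      obtain ⟨A, hA, hsA, hAs⟩ := h s (mem_insert_self _ _)
      have := card_image_iff.1 heq (mem_coe.2 hA) (mem_coe.2 hAs)
        (by simp [erase_insert hsA, erase_eq_of_notMem hsA])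
      exact hsA (this ▸ mem_insert_self s A)
    rw [card_insert_of_notMem hs]
    omega

section

variable {G : SimpleGraph V} {T : Finset V} {k : ℕ}

open scoped Classical in
/-- The inessential neighbours of `v` outside `T`. -/
noncomputable def inessentialNbrs (G : SimpleGraph V) (T : Finset V) (v : V) : Finset V :=
  univ.filter fun w => w ∉ T ∧ ¬IsEssential G T w ∧ G.Adj v w

/-- The vertices of `T` with inessential neighbourhood `D`. -/
noncomputable def innerClass (G : SimpleGraph V) (T D : Finset V) : Finset V :=
  T.filter fun u => inessentialNbrs G T u = D

open scoped Classical in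
/-- The inessential vertices outside `T` with closed inessential neighbourhood `D`. -/
noncomputable def outerClass (G : SimpleGraph V) (T D : Finset V) : Finset V :=
  univ.filter fun s => s ∉ T ∧ ¬IsEssential G T s ∧ insert s (inessentialNbrs G T s) = D

lemma mem_inessentialNbrs {v w : V} :
    w ∈ inessentialNbrs G T v ↔ w ∉ T ∧ ¬IsEssential G T w ∧ G.Adj v w := by
  simp [inessentialNbrs]

lemma mem_innerClass {D : Finset V} {u : V} :
    u ∈ innerClass G T D ↔ u ∈ T ∧ inessentialNbrs G T u = D := by
  simp [innerClass]

lemma mem_outerClass {D : Finset V} {s : V} :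
    s ∈ outerClass G T D ↔
      s ∉ T ∧ ¬IsEssential G T s ∧ insert s (inessentialNbrs G T s) = D := by
  simp [outerClass]

lemma outerClass_subset {D : Finset V} : outerClass G T D ⊆ D := fun s hs =>
  (mem_outerClass.1 hs).2.2 ▸ mem_insert_self s _

lemma adj_of_mem_of_mem_outerClass {D : Finset V} {d s : V} (hd : d ∈ D)
    (hs : s ∈ outerClass G T D) (hne : d ≠ s) : G.Adj d s := by
  rw [← (mem_outerClass.1 hs).2.2] at hd
  exact (mem_inessentialNbrs.1 ((mem_insert.1 hd).resolve_left hne)).2.2.symm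

lemma adj_of_mem_innerClass {D : Finset V} {u d : V} (hu : u ∈ innerClass G T D) (hd : d ∈ D) :
    G.Adj u d := by
  rw [← (mem_innerClass.1 hu).2] at hd
  exact (mem_inessentialNbrs.1 hd).2.2

lemma isClique_insert_outerClass {D : Finset V} {u : V} (hu : u ∈ innerClass G T D) :
    G.IsClique (insert u (outerClass G T D) : Finset V) := by
  have h : G.IsClique (outerClass G T D : Set V) := fun a ha b hb hab =>
    adj_of_mem_of_mem_outerClass (outerClass_subset ha) hb hab
  rw [coe_insert]
  exact h.insert fun b hb _ => adj_of_mem_innerClass hu (outerClass_subset hb)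

lemma card_outerClass_add_one_le {D : Finset V} {u : V} (hu : u ∈ innerClass G T D) :
    #(outerClass G T D) + 1 ≤ G.cliqueNum := by
  have hcard := (isClique_insert_outerClass hu).card_le_cliqueNum
  rwa [card_insert_of_notMem fun h => (mem_outerClass.1 h).1 (mem_innerClass.1 hu).1] at hcard

lemma card_outerClass_add_two_le {D : Finset V} {u w : V} (hu : u ∈ innerClass G T D)
    (huw : G.Adj w u) (hw : w ∉ outerClass G T D) (h : ∀ s ∈ outerClass G T D, G.Adj w s) :
    #(outerClass G T D) + 2 ≤ G.cliqueNum := by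
  have hcl : G.IsClique (insert w (insert u (outerClass G T D)) : Finset V) := by
    rw [coe_insert]
    refine (isClique_insert_outerClass hu).insert fun b hb _ => ?_
    rcases mem_insert.1 (mem_coe.1 hb) with rfl | hb
    · exact huw
    · exact h b hb
  have hcard := hcl.card_le_cliqueNum
  rwa [card_insert_of_notMem, card_insert_of_notMem] at hcard
  · exact fun h => (mem_outerClass.1 h).1 (mem_innerClass.1 hu).1
  · rw [mem_insert]
    rintro (rfl | h)
    · exact G.loopless.irrefl _ huw
    · exact hw h

lemma isExcess_of_card_eq (hω : G.cliqueNum = k + 1) (hT : OuterSeparated G T)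
    (hmax : ∀ T', OuterSeparated G T' → #T' ≤ #T) {D : Finset V} {v : V}
    (hv : innerClass G T D = {v}) (hD : #(outerClass G T D) = k) :
    outerClass G T D = D ∧ IsExcess G T k v D := by
  have hvD : v ∈ innerClass G T D := hv ▸ mem_singleton_self v
  have hext : ∀ w, G.Adj w v → (∀ s ∈ outerClass G T D, w ≠ s → G.Adj w s) →
      w ∈ outerClass G T D := by
    intro w hw h
    by_contra hwD
    have := card_outerClass_add_two_le hvD hw hwD fun s hs => h s hs fun hws => hwD (hws ▸ hs)
    omega
  have hout : outerClass G T D = D := Subset.antisymm outerClass_subset fun d hd =>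
    hext d (adj_of_mem_innerClass hvD hd).symm fun s hs => adj_of_mem_of_mem_outerClass hd hs
  rw [hout] at hD hext
  have hmem : ∀ s ∈ D, s ∉ T ∧ ¬IsEssential G T s ∧ insert s (inessentialNbrs G T s) = D :=
    fun s hs => mem_outerClass.1 (hout.symm ▸ hs)
  have htwin : ∀ s ∈ D, ∀ w, w ∉ T → w ≠ s → (G.Adj w s ↔ G.Adj w v) := by
    intro s hs
    obtain ⟨hsT, hess, hsD⟩ := hmem s hs
    obtain ⟨u, hu, hsu, h⟩ := hT.exists_twin hmax hsT hess
    have huD : u ∈ innerClass G T D := by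
      refine mem_innerClass.2 ⟨hu, ?_⟩
      rw [← hsD]
      ext w
      rw [mem_insert, mem_inessentialNbrs, mem_inessentialNbrs]
      by_cases hws : w = s
      · subst hws
        simp [hsT, hess, hsu.symm]
      · have := h w
        rw [G.adj_comm u w, G.adj_comm s w]
        tauto
    rw [hv, mem_singleton] at huD
    exact huD ▸ h
  have hadj : ∀ w, w ∉ T → (G.Adj v w ↔ w ∈ D) := fun w hw =>
    ⟨fun h => hext w h.symm fun s hs hws => (htwin s hs w hw hws).2 h.symm,
      adj_of_mem_innerClass hvD⟩
  refine ⟨hout, (mem_innerClass.1 hvD).1, hD, fun f hf => (hmem f hf).1,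
    fun f hf => (hmem f hf).2.1, hadj, fun f hf w hw => ?_, fun u hu h => ?_⟩
  · by_cases hwf : w = f
    · simp [hwf]
    · rw [G.adj_comm, htwin f hf w hw hwf, G.adj_comm, hadj w hw]
      simp [hwf]
  · rw [← mem_singleton, ← hv]
    refine mem_innerClass.2 ⟨hu, ?_⟩
    ext w
    rw [mem_inessentialNbrs]
    constructor
    · exact fun hw => (h w hw.1 hw.2.1).1 hw.2.2
    · exact fun hw => ⟨(hmem w hw).1, (hmem w hw).2.1, (h w (hmem w hw).1 (hmem w hw).2.1).2 hw⟩

lemma card_lt_card_innerClass {D L : Finset V} (hD : (innerClass G T D).Nonempty)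
    (hL : ∀ s ∈ L, ∃ a ∈ innerClass G T D, ∃ b ∈ innerClass G T D, G.Adj s a ∧ ¬G.Adj s b ∧
      ∀ w, w ∉ T → w ≠ s → (G.Adj w a ↔ G.Adj w b)) (hLT : ∀ s ∈ L, s ∉ T) :
    #L < #(innerClass G T D) := by
  classical
  refine lt_of_lt_of_le (card_lt_of_forall_insert_mem L
    ((innerClass G T D).image fun u => L.filter (G.Adj u)) (hD.image _) fun s hs => ?_)
    card_image_le
  obtain ⟨a, ha, b, hb, hsa, hsb, h⟩ := hL s hs
  refine ⟨_, mem_image_of_mem _ hb, fun h => hsb (mem_filter.1 h).2.symm, ?_⟩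
  refine mem_image.2 ⟨a, ha, ?_⟩
  ext w
  rw [mem_insert, mem_filter, mem_filter]
  by_cases hws : w = s
  · subst hws
    simp [hs, hsa.symm]
  · have h1 := h w
    have h2 := hLT w
    rw [G.adj_comm a w, G.adj_comm b w]
    tauto

/-- Excess classes to which a further vertex of `T` is attached by a single edge can be assigned,
injectively, classes without inessential outer vertices. -/
lemma exists_injOn_outerClass_eq_empty (hc : G.Connected) (hk : 2 ≤ k)
    (X : Finset (Finset V))
    (hX : ∀ D ∈ X, outerClass G T D = D ∧ ∃ v, IsExcess G T k v D ∧
      innerClass G T D = {v} ∧ ∃ u ∈ T, u ≠ v ∧ ∃ f ∈ D, G.Adj u f ∧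
      (∀ g ∈ D, g ≠ f → ¬G.Adj u g) ∧ #((outerNbrs G T u).erase f) = k ∧
      ∀ a ∈ (outerNbrs G T u).erase f, ∀ b ∈ (outerNbrs G T u).erase f, a ≠ b → G.Adj a b) :
    ∃ χ : Finset V → Finset V, Set.InjOn χ X ∧ ∀ D ∈ X,
      (innerClass G T (χ D)).Nonempty ∧ outerClass G T (χ D) = ∅ := by
  have := hc.nonempty
  choose! hout v he hv u hu huv f hf huf hug hcard hclique using hX
  have hfu : ∀ D ∈ X, f D ∈ inessentialNbrs G T (u D) := fun D hD =>
    mem_inessentialNbrs.2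
      ⟨(he D hD).notMem _ (hf D hD), (he D hD).inessential _ (hf D hD), huf D hD⟩
  have hclosed : ∀ D ∈ X, ∀ s ∈ D, insert s (inessentialNbrs G T s) = D := fun D hD s hs =>
    (mem_outerClass.1 ((hout D hD).symm ▸ hs)).2.2
  refine ⟨fun D => inessentialNbrs G T (u D), ?_, fun D hD => ⟨⟨u D, ?_⟩, ?_⟩⟩
  · intro D₁ h₁ D₂ h₂ heq
    rw [mem_coe] at h₁ h₂
    by_contra hne
    have hf₂ := hfu D₂ h₂
    dsimp only at heq
    rw [← heq, mem_inessentialNbrs] at hf₂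
    have hff : f D₂ ≠ f D₁ := fun h => hne <| by
      rw [← hclosed D₁ h₁ _ (hf D₁ h₁), ← h, hclosed D₂ h₂ _ (hf D₂ h₂)]
    have hf₂' : f D₂ ∈ (outerNbrs G T (u D₁)).erase (f D₁) :=
      mem_erase.2 ⟨hff, mem_outerNbrs.2 ⟨hf₂.1, hf₂.2.2⟩⟩
    have hsub : (outerNbrs G T (u D₁)).erase (f D₁) ⊆ D₂ := by
      intro g hg
      by_cases hgf : f D₂ = g
      · exact hgf ▸ hf D₂ h₂
      · exact (((he D₂ h₂).adj_iff_of_mem _ (hf D₂ h₂) g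
          (mem_outerNbrs.1 (mem_of_mem_erase hg)).1).1 (hclique D₁ h₁ _ hf₂' g hg hgf)).1
    have hD₂ := eq_of_subset_of_card_le hsub (by rw [(he D₂ h₂).card_eq, hcard D₁ h₁])
    obtain ⟨g, hg, hgf⟩ := exists_mem_ne (s := D₂) (by rw [(he D₂ h₂).card_eq]; omega) (f D₂)
    have hgu : g ∈ inessentialNbrs G T (u D₁) := by
      refine mem_inessentialNbrs.2 ⟨(he D₂ h₂).notMem g hg, (he D₂ h₂).inessential g hg, ?_⟩
      rw [← hD₂] at hg
      exact (mem_outerNbrs.1 (mem_of_mem_erase hg)).2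
    rw [heq] at hgu
    exact hug D₂ h₂ g hg hgf (mem_inessentialNbrs.1 hgu).2.2
  · exact mem_innerClass.2 ⟨hu D hD, rfl⟩
  · refine eq_empty_of_forall_notMem fun s hs => huv D hD ?_
    have hs' := mem_outerClass.1 hs
    have hsD : s ∈ D := by
      by_cases hsf : f D = s
      · exact hsf ▸ hf D hD
      · exact (((he D hD).adj_iff_of_mem _ (hf D hD) s hs'.1).1
          (adj_of_mem_of_mem_outerClass (hfu D hD) hs hsf)).1
    rw [← mem_singleton, ← hv D hD]
    exact mem_innerClass.2 ⟨hu D hD, hs'.2.2.symm.trans (hclosed D hD s hsD)⟩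

lemma exists_outerSeparated_card_le (hc : G.Connected) (hk : 2 ≤ k) (hω : G.cliqueNum = k + 1)
    (hn : k + 2 ≤ Fintype.card V) :
    ∃ T, OuterSeparated G T ∧ Fintype.card V ≤ k * #T := by
  classical
  obtain ⟨T₀, hT₀, hmax₀⟩ := exists_max_image (univ.filter (OuterSeparated G)) card
    ⟨∅, by simp [OuterSeparated]⟩
  obtain ⟨T, hT, hmin⟩ := exists_min_image
    (univ.filter fun T => OuterSeparated G T ∧ #T = #T₀)
    (fun T => #(univ.filter (HasCliqueComponent G T k))) ⟨T₀, by simpa using hT₀⟩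
  simp only [mem_filter, mem_univ, true_and] at hT₀ hmax₀ hT hmin
  obtain ⟨hT, hTcard⟩ := hT
  have hmax : ∀ T', OuterSeparated G T' → #T' ≤ #T := by
    rw [hTcard]
    exact hmax₀
  replace hmin : ∀ T', OuterSeparated G T' → #T' = #T →
      #(univ.filter (HasCliqueComponent G T k)) ≤ #(univ.filter (HasCliqueComponent G T' k)) :=
    fun T' h h' => hmin T' ⟨h, h'.trans hTcard⟩
  refine ⟨T, hT, ?_⟩
  have hess : ∀ s, IsEssential G T s → ∃ a ∈ T, ∃ b ∈ T, G.Adj a b ∧ G.Adj s a ∧ ¬G.Adj s b ∧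
    ∀ w, w ∉ T → w ≠ s → (G.Adj w a ↔ G.Adj w b) := fun s h => h
  choose! a haT b hbT hab hsa hsb hsame using hess
  set 𝒟 := T.image (inessentialNbrs G T)
  set E := univ.filter fun s => s ∉ T ∧ IsEssential G T s with hE
  set I := univ.filter fun s => s ∉ T ∧ ¬IsEssential G T s with hI
  set e : Finset V → ℕ := fun D => #(E.filter fun s => inessentialNbrs G T (a s) = D) with he
  have hsum_inner : #T = ∑ D ∈ 𝒟, #(innerClass G T D) :=
    card_eq_sum_card_fiberwise fun u hu => mem_image_of_mem _ hu
  have hsum_essential : #E = ∑ D ∈ 𝒟, e D :=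
    card_eq_sum_card_fiberwise fun s hs => mem_image_of_mem _ (haT s (by simp_all))
  have hsum_outer : #I = ∑ D ∈ 𝒟, #(outerClass G T D) := by
    rw [card_eq_sum_card_fiberwise (f := fun s => insert s (inessentialNbrs G T s)) (t := 𝒟)]
    · refine sum_congr rfl fun D _ => congrArg card ?_
      ext s
      simp [mem_outerClass, hI, and_assoc]
    · intro s hs
      have hs' : s ∉ T ∧ ¬IsEssential G T s := by simpa [hI] using hs
      obtain ⟨u, hu, hsu, h⟩ := hT.exists_twin hmax hs'.1 hs'.2
      refine mem_image.2 ⟨u, hu, ?_⟩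
      ext w
      rw [mem_insert, mem_inessentialNbrs, mem_inessentialNbrs]
      by_cases hws : w = s
      · subst hws
        simp [hs', hsu.symm]
      · have := h w
        rw [G.adj_comm u w, G.adj_comm s w]
        tauto
  have htotal : Fintype.card V = #T + #E + #I := by
    have h₁ : #Tᶜ = #E + #I := by
      rw [← card_filter_add_card_filter_not (s := Tᶜ) (IsEssential G T)]
      congr 2 <;> ext s <;> simp [hE, hI]
    have h₂ := card_add_card_compl T
    omega
  have hpair : ∀ D, ∀ s ∈ E.filter (fun s => inessentialNbrs G T (a s) = D),
      a s ∈ innerClass G T D ∧ b s ∈ innerClass G T D := by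
    intro D s hs
    obtain ⟨hsE, rfl⟩ := mem_filter.1 hs
    have hs' : s ∉ T ∧ IsEssential G T s := by simpa [hE] using hsE
    refine ⟨mem_innerClass.2 ⟨haT s hs'.2, rfl⟩, mem_innerClass.2 ⟨hbT s hs'.2, ?_⟩⟩
    ext w
    rw [mem_inessentialNbrs, mem_inessentialNbrs]
    have h₁ := hsame s hs'.2 w
    have h₂ : ¬IsEssential G T w → w ≠ s := fun h hws => h (hws ▸ hs'.2)
    rw [G.adj_comm _ w, G.adj_comm _ w]
    tauto
  have hE_mem : ∀ s ∈ E, s ∉ T ∧ IsEssential G T s := fun s hs => by simpa [hE] using hs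
  have hnonempty : ∀ D ∈ 𝒟, (innerClass G T D).Nonempty := fun D hD => by
    obtain ⟨u, hu, rfl⟩ := mem_image.1 hD
    exact ⟨u, mem_innerClass.2 ⟨hu, rfl⟩⟩
  have he_lt : ∀ D ∈ 𝒟, e D < #(innerClass G T D) := fun D hD => by
    refine card_lt_card_innerClass (hnonempty D hD) (fun s hs => ?_)
      fun s hs => (hE_mem s (mem_filter.1 hs).1).1
    have hs' := (hE_mem s (mem_filter.1 hs).1).2
    exact ⟨a s, (hpair D s hs).1, b s, (hpair D s hs).2, hsa s hs', hsb s hs', hsame s hs'⟩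
  have houter : ∀ D ∈ 𝒟, #(outerClass G T D) ≤ k := fun D hD => by
    obtain ⟨u, hu⟩ := hnonempty D hD
    have := card_outerClass_add_one_le hu
    omega
  have houter' : ∀ D, e D ≠ 0 → #(outerClass G T D) + 1 ≤ k := fun D hD => by
    obtain ⟨s, hs⟩ := card_ne_zero.1 hD
    obtain ⟨ha, hb⟩ := hpair D s hs
    have := card_outerClass_add_two_le hb (hab s (hE_mem s (mem_filter.1 hs).1).2)
      (fun h => (mem_outerClass.1 h).1 (mem_innerClass.1 ha).1)
      fun d hd => adj_of_mem_innerClass ha (outerClass_subset hd)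
    omega
  set X := 𝒟.filter fun D => #(innerClass G T D) = 1 ∧ #(outerClass G T D) = k
  obtain ⟨χ, hinj, hχ⟩ := exists_injOn_outerClass_eq_empty hc hk X fun D hD => by
    obtain ⟨-, h₁, h₂⟩ := mem_filter.1 hD
    obtain ⟨v, hv⟩ := card_eq_one.1 h₁
    obtain ⟨hout, hex⟩ := isExcess_of_card_eq hω hT hmax hv h₂
    exact ⟨hout, v, hex, hv, hex.exists_attached hc hω hn hT hmin⟩
  have hχ𝒟 : X.image χ ⊆ 𝒟 := fun D hD => by
    obtain ⟨D', hD', rfl⟩ := mem_image.1 hD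
    obtain ⟨u, hu⟩ := (hχ D' hD').1
    exact mem_image.2 ⟨u, mem_innerClass.1 hu⟩
  have hX𝒟 : X ⊆ 𝒟 := filter_subset _ _
  have hpoint : ∀ D ∈ 𝒟, #(innerClass G T D) + e D + #(outerClass G T D) +
      (if D ∈ X.image χ then 1 else 0) ≤ k * #(innerClass G T D) + if D ∈ X then 1 else 0 := by
    intro D hD
    have hlt := he_lt D hD
    by_cases hDχ : D ∈ X.image χ
    · obtain ⟨D', hD', rfl⟩ := mem_image.1 hDχ
      have : #(outerClass G T (χ D')) = 0 := by rw [(hχ D' hD').2, card_empty]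
      have := Nat.mul_le_mul_right #(innerClass G T (χ D')) hk
      rw [if_pos hDχ]
      omega
    · rw [if_neg hDχ]
      have h₁ := houter D hD
      by_cases h₀ : e D = 0
      · by_cases hm : #(innerClass G T D) = 1
        · by_cases hDX : D ∈ X
          · rw [if_pos hDX, hm]
            omega
          · have : #(outerClass G T D) ≠ k := fun h => hDX (mem_filter.2 ⟨hD, hm, h⟩)
            rw [if_neg hDX, hm]
            omega
        · have : 2 ≤ #(innerClass G T D) := by omega
          have : #(innerClass G T D) + k ≤ k * #(innerClass G T D) := by nlinarith
          omega
      · have h₂ := houter' D h₀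
        have : 2 * #(innerClass G T D) + k ≤ k * #(innerClass G T D) + 2 := by
          obtain ⟨j, rfl⟩ := Nat.exists_eq_add_of_le hk
          nlinarith
        omega
  have hsum := sum_le_sum hpoint
  simp only [sum_add_distrib, ← mul_sum, sum_ite_mem, sum_const, smul_eq_mul, mul_one] at hsum
  rw [inter_eq_right.2 hχ𝒟, inter_eq_right.2 hX𝒟,
    card_image_of_injOn hinj] at hsum
  rw [htotal, hsum_essential, hsum_outer]
  rw [← hsum_inner] at hsum
  omega

end

lemma OuterSeparated.isLocalResolving_compl {G : SimpleGraph V} {T : Finset V}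
    (hT : OuterSeparated G T) : IsLocalResolving G Tᶜ := by
  intro u v huv hu hv
  rw [mem_compl, not_not] at hu hv
  obtain ⟨w, hw, hne⟩ := hT u hu v hv huv
  refine ⟨w, mem_compl.2 hw, fun h => hne ?_⟩
  rw [G.adj_comm w u, G.adj_comm w v, ← SimpleGraph.dist_eq_one_iff_adj, h,
    SimpleGraph.dist_eq_one_iff_adj]

theorem dimL_le_floor (G : SimpleGraph V) (hc : G.Connected)
    (h1 : G.cliqueNum + 1 ≤ Fintype.card V) (h2 : 4 ≤ G.cliqueNum + 1) :
    (dimL G : ℤ) ≤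
      ⌊(((G.cliqueNum : ℚ) - 2) / ((G.cliqueNum : ℚ) - 1)) * (Fintype.card V : ℚ)⌋ := by
  obtain ⟨k, hω⟩ : ∃ k, G.cliqueNum = k + 1 := ⟨G.cliqueNum - 1, by omega⟩
  obtain ⟨T, hT, hcard⟩ := exists_outerSeparated_card_le hc (k := k) (by omega) hω (by omega)
  have hdim : dimL G ≤ #Tᶜ := Nat.sInf_le ⟨Tᶜ, rfl, hT.isLocalResolving_compl⟩
  have hsum := card_add_card_compl T
  have hk : (0 : ℚ) < k := by
    exact_mod_cast (by omega : 0 < k)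
  have hle : k * dimL G + Fintype.card V ≤ k * Fintype.card V := by nlinarith
  have hle' : (k : ℚ) * dimL G + Fintype.card V ≤ k * Fintype.card V := by exact_mod_cast hle
  rw [Int.le_floor, hω]
  push_cast
  rw [add_sub_cancel_right, div_mul_eq_mul_div, le_div_iff₀ hk]
  linarith
end

section
/- If G is a finite simple connected graph with n(G) ≥ 4 and clique number ω(G) = 3, then dim_{A,l}(G) ≤ ⌊n(G)/2⌋. -/
open SimpleGraph

variable {V : Type*} [Fintype V] [DecidableEq V]

section

variable {α : Type*} [DecidableEq α]

/-- `S` separates all adjacent pairs of `U \ S`. -/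
def ResolvesOn (G : SimpleGraph α) (U S : Finset α) : Prop :=
  ∀ u ∈ U, ∀ v ∈ U, G.Adj u v → u ∉ S → v ∉ S → ∃ w ∈ S, ¬(G.Adj w u ↔ G.Adj w v)

/-- There is no set of four pairwise adjacent vertices. -/
def NoFourClique (G : SimpleGraph α) : Prop :=
  ∀ a b c d, G.Adj a b → G.Adj a c → G.Adj a d → G.Adj b c → G.Adj b d → ¬G.Adj c d

open Classical in
/-- The neighbours of `v` in `U`. -/
noncomputable def nbrIn (G : SimpleGraph α) (U : Finset α) (v : α) : Finset α :=
  U.filter (G.Adj v)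

open Classical in
/-- The vertices of `U` different from `v` and not adjacent to `v`. -/
noncomputable def farIn (G : SimpleGraph α) (U : Finset α) (v : α) : Finset α :=
  U.filter fun x => x ≠ v ∧ ¬G.Adj v x

/-- `X` is a triangle. -/
def IsTriangle (G : SimpleGraph α) (X : Finset α) : Prop :=
  X.card = 3 ∧ ∀ x ∈ X, ∀ y ∈ X, x ≠ y → G.Adj x y

open Classical in
/-- The triangles that are connected components of `G[U]`. -/
noncomputable def triComps (G : SimpleGraph α) (U : Finset α) : Finset (Finset α) :=
  U.powerset.filter fun X => IsTriangle G X ∧ ∀ x ∈ X, ∀ y ∈ U, y ∉ X → ¬G.Adj x y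

/-- Some vertex of `C` separates two vertices of `X`. -/
def Splits (G : SimpleGraph α) (C X : Finset α) : Prop :=
  ∃ c ∈ C, ∃ x ∈ X, ∃ y ∈ X, G.Adj c x ∧ ¬G.Adj c y

/-- `G[U]` has no partition into two nonempty parts without an edge between them. -/
def ConnectedOn (G : SimpleGraph α) (U : Finset α) : Prop :=
  ∀ P ⊆ U, P.Nonempty → P ≠ U → ∃ x ∈ P, ∃ y ∈ U, y ∉ P ∧ G.Adj x y

open Classical in
/-- Relative to any preselected set `C`, `G[U]` is resolved by adding at most half of its vertices,
with a correction of one half for each triangle component, in the direction that depends on whether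
`C` splits it. -/
def HalfBound (G : SimpleGraph α) (U : Finset α) : Prop :=
  ∀ C : Finset α, ∃ S ⊆ U, ResolvesOn G U (C ∪ S) ∧
    2 * S.card + ((triComps G U).filter (Splits G C)).card ≤
      U.card + ((triComps G U).filter fun X => ¬Splits G C X).card

variable {G : SimpleGraph α}

omit [DecidableEq α] in
lemma mem_nbrIn {U : Finset α} {v x : α} : x ∈ nbrIn G U v ↔ x ∈ U ∧ G.Adj v x := by
  simp [nbrIn]

lemma mem_farIn {U : Finset α} {v x : α} :
    x ∈ farIn G U v ↔ x ∈ U ∧ x ≠ v ∧ ¬G.Adj v x := by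
  simp [farIn]

lemma mem_triComps {U X : Finset α} : X ∈ triComps G U ↔
    X ⊆ U ∧ IsTriangle G X ∧ ∀ x ∈ X, ∀ y ∈ U, y ∉ X → ¬G.Adj x y := by
  simp [triComps]

omit [DecidableEq α] in
lemma ResolvesOn.mono {U S T : Finset α} (h : ResolvesOn G U S) (hST : S ⊆ T) :
    ResolvesOn G U T := fun u hu v hv huv huT hvT =>
  let ⟨w, hw, hne⟩ := h u hu v hv huv (fun h => huT (hST h)) (fun h => hvT (hST h))
  ⟨w, hST hw, hne⟩

lemma card_eq_nbrIn_add_farIn {U : Finset α} {v : α} (hv : v ∈ U) :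
    U.card = 1 + (nbrIn G U v).card + (farIn G U v).card := by
  have h1 : U = insert v (nbrIn G U v ∪ farIn G U v) := by
    ext x
    simp only [Finset.mem_insert, Finset.mem_union, mem_nbrIn, mem_farIn]
    grind
  have h2 : Disjoint (nbrIn G U v) (farIn G U v) := by
    rw [Finset.disjoint_left]
    intro x
    simp only [mem_nbrIn, mem_farIn]
    tauto
  have h3 : v ∉ nbrIn G U v ∪ farIn G U v := by
    simp [mem_nbrIn, mem_farIn]
  conv_lhs => rw [h1]
  rw [Finset.card_insert_of_notMem h3, Finset.card_union_of_disjoint h2]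
  omega

lemma splits_of_adj (h4 : NoFourClique G) {X C : Finset α} (hX : IsTriangle G X) {c x : α}
    (hc : c ∈ C) (hx : x ∈ X) (hcx : G.Adj c x) : Splits G C X := by
  obtain ⟨hcard, hadj⟩ := hX
  obtain ⟨p, q, r, hpq, hpr, hqr, rfl⟩ := Finset.card_eq_three.mp hcard
  by_contra hcon
  have hall : ∀ y ∈ ({p, q, r} : Finset α), G.Adj c y := by
    intro y hy
    by_contra hcy
    exact hcon ⟨c, hc, x, hx, y, hy, hcx, hcy⟩
  exact h4 c p q r (hall p (by simp)) (hall q (by simp)) (hall r (by simp))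
    (hadj p (by simp) q (by simp) hpq) (hadj p (by simp) r (by simp) hpr)
    (hadj q (by simp) r (by simp) hqr)

lemma exists_resolvesOn_of_splits {X C : Finset α} (hX : IsTriangle G X) (hs : Splits G C X) :
    ∃ p ∈ X, ResolvesOn G X (C ∪ {p}) := by
  obtain ⟨hcard, hadj⟩ := hX
  obtain ⟨c, hc, x, hx, y, hy, hcx, hcy⟩ := hs
  have hxy : x ≠ y := by
    rintro rfl
    exact hcy hcx
  obtain ⟨z, hz⟩ : ∃ z, z ∈ (X.erase x).erase y := by
    apply Finset.card_pos.mp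
    rw [Finset.card_erase_of_mem (by simp [hy, hxy.symm]), Finset.card_erase_of_mem hx]
    omega
  have hXe : X = {x, y, z} := by
    symm
    apply Finset.eq_of_subset_of_card_le
    · intro t
      simp at hz ⊢
      grind
    · rw [hcard, Finset.card_eq_three.mpr]
      simp at hz
      exact ⟨x, y, z, hxy, by grind, by grind, rfl⟩
  refine ⟨z, by simp at hz; tauto, ?_⟩
  intro u hu v hv huv hu' hv'
  refine ⟨c, by simp [hc], ?_⟩
  have := huv.ne
  subst hXe
  simp at hu hv hu' hv'
  grind

/-- Maximal independent sets: `B` is independent, contains `I`, avoids `y`, and dominates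
`W \ {y}`. -/
lemma exists_maximal_independent (W I : Finset α) (y : α) (hIW : I ⊆ W.erase y)
    (hI : ∀ a ∈ I, ∀ b ∈ I, ¬G.Adj a b) :
    ∃ B ⊆ W, I ⊆ B ∧ y ∉ B ∧ (∀ a ∈ B, ∀ b ∈ B, ¬G.Adj a b) ∧
      ∀ u ∈ W, u ≠ y → u ∉ B → ∃ b ∈ B, G.Adj u b := by
  classical
  let F := (W.erase y).powerset.filter fun B => I ⊆ B ∧ ∀ a ∈ B, ∀ b ∈ B, ¬G.Adj a b
  have hF : F.Nonempty := ⟨I, by simp only [F, Finset.mem_filter, Finset.mem_powerset]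
                                 exact ⟨hIW, subset_rfl, hI⟩⟩
  obtain ⟨B, hB, hmax⟩ := Finset.exists_max_image F Finset.card hF
  simp only [F, Finset.mem_filter, Finset.mem_powerset] at hB hmax
  obtain ⟨hBW, hIB, hBi⟩ := hB
  refine ⟨B, hBW.trans (Finset.erase_subset _ _), hIB, fun h => by simpa using hBW h, hBi, ?_⟩
  intro u hu huy huB
  by_contra! hno
  have := hmax (insert u B) ⟨?_, hIB.trans (Finset.subset_insert _ _), ?_⟩
  · rw [Finset.card_insert_of_notMem huB] at this
    omega
  · intro t ht
    rcases Finset.mem_insert.mp ht with rfl | ht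
    · simp [hu, huy]
    · exact hBW ht
  · intro a ha b hb
    rcases Finset.mem_insert.mp ha with ha | ha <;>
      rcases Finset.mem_insert.mp hb with hb | hb
    · exact ha ▸ hb ▸ G.loopless.irrefl _
    · exact ha ▸ hno b hb
    · exact fun h => hno a ha (hb ▸ h.symm)
    · exact hBi a ha b hb

/-- In a triangle-free part, some set and its complement are both resolving, and the set can be
chosen to contain a given independent set `I` and to avoid a given vertex. -/
lemma exists_resolvesOn_pair {W I : Finset α} (y : α)
    (h3 : ∀ a ∈ W, ∀ b ∈ W, ∀ c ∈ W, G.Adj a b → G.Adj a c → ¬G.Adj b c)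
    (hIW : I ⊆ W.erase y) (hI : ∀ a ∈ I, ∀ b ∈ I, ¬G.Adj a b) :
    ∃ B ⊆ W, I ⊆ B ∧ y ∉ B ∧ ResolvesOn G W B ∧ ResolvesOn G W (W \ B) := by
  obtain ⟨B, hBW, hIB, hyB, hind, hdom⟩ := exists_maximal_independent W I y hIW hI
  refine ⟨B, hBW, hIB, hyB, ?_, ?_⟩
  · intro u hu v hv huv huB hvB
    by_cases huy : u = y
    · have hvy : v ≠ y := fun h => huv.ne (huy.trans h.symm)
      obtain ⟨b, hb, hvb⟩ := hdom v hv hvy hvB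
      exact ⟨b, hb, fun h => h3 v hv u hu b (hBW hb) huv.symm hvb (h.mpr hvb.symm).symm⟩
    · obtain ⟨b, hb, hub⟩ := hdom u hu huy huB
      exact ⟨b, hb, fun h => h3 u hu v hv b (hBW hb) huv hub (h.mp hub.symm).symm⟩
  · intro u hu v hv huv hu' hv'
    exact absurd huv (hind u (by simpa [hu] using hu') v (by simpa [hv] using hv'))

lemma farIn_ssubset {U : Finset α} {v : α} (hv : v ∈ U) : farIn G U v ⊂ U := by
  refine Finset.ssubset_iff_subset_ne.mpr ⟨fun x hx => (mem_farIn.mp hx).1, fun h => ?_⟩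
  have := h ▸ hv
  simp [mem_farIn] at this

omit [DecidableEq α] in
lemma nbrIn_triangleFree (h4 : NoFourClique G) {U : Finset α} {v : α} :
    ∀ a ∈ nbrIn G U v, ∀ b ∈ nbrIn G U v, ∀ c ∈ nbrIn G U v,
      G.Adj a b → G.Adj a c → ¬G.Adj b c := by
  intro a ha b hb c hc hab hac
  rw [mem_nbrIn] at ha hb hc
  exact h4 v a b c ha.2 hb.2 hc.2 hab hac

open Classical in
/-- Selecting `v` splits the problem into the neighbours of `v` and the remaining vertices. -/
lemma exists_resolvesOn_of_nbrIn {U A : Finset α} {v : α} (hv : v ∈ U)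
    (hR : HalfBound G (farIn G U v)) (hA : A ⊆ nbrIn G U v)
    (hAr : ResolvesOn G (nbrIn G U v) A) :
    ∃ S ⊆ U, v ∈ S ∧ ResolvesOn G U S ∧
      2 * S.card + ((triComps G (farIn G U v)).filter (Splits G A)).card ≤
        2 + 2 * A.card + (farIn G U v).card +
          ((triComps G (farIn G U v)).filter fun X => ¬Splits G A X).card := by
  obtain ⟨S, hS, hres, hcard⟩ := hR A
  refine ⟨insert v (A ∪ S), ?_, by simp, ?_, ?_⟩
  · intro x hx
    rcases Finset.mem_insert.mp hx with rfl | hx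
    · exact hv
    · rcases Finset.mem_union.mp hx with hx | hx
      · exact (mem_nbrIn.mp (hA hx)).1
      · exact (mem_farIn.mp (hS hx)).1
  · intro a ha b hb hab haS hbS
    have hav : a ≠ v := fun h => haS (by simp [h])
    have hbv : b ≠ v := fun h => hbS (by simp [h])
    by_cases h : G.Adj v a ↔ G.Adj v b
    · by_cases hva : G.Adj v a
      · exact hAr.mono (fun x hx => by simp [hx]) a (mem_nbrIn.mpr ⟨ha, hva⟩) b
          (mem_nbrIn.mpr ⟨hb, h.mp hva⟩) hab haS hbS
      · exact hres.mono (Finset.subset_insert _ _) a (mem_farIn.mpr ⟨ha, hav, hva⟩) b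
          (mem_farIn.mpr ⟨hb, hbv, fun h' => hva (h.mpr h')⟩) hab haS hbS
    · exact ⟨v, by simp, h⟩
  · have h1 := Finset.card_insert_le v (A ∪ S)
    have h2 := Finset.card_union_le A S
    omega

open Classical in
/-- The better of two choices inside the neighbourhood of `v`. -/
lemma exists_resolvesOn_of_pair {U A B : Finset α} {v : α} (hv : v ∈ U)
    (hR : HalfBound G (farIn G U v)) (hA : A ⊆ nbrIn G U v) (hB : B ⊆ nbrIn G U v)
    (hAr : ResolvesOn G (nbrIn G U v) A) (hBr : ResolvesOn G (nbrIn G U v) B)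
    (hcov : ∀ X ∈ triComps G (farIn G U v), Splits G A X ∨ Splits G B X) :
    ∃ S ⊆ U, v ∈ S ∧ ResolvesOn G U S ∧
      2 * S.card +
        ((triComps G (farIn G U v)).filter fun X => Splits G A X ∧ Splits G B X).card ≤
          2 + A.card + B.card + (farIn G U v).card := by
  obtain ⟨S, hSU, hvS, hSr, hS⟩ := exists_resolvesOn_of_nbrIn hv hR hA hAr
  obtain ⟨T, hTU, hvT, hTr, hT⟩ := exists_resolvesOn_of_nbrIn hv hR hB hBr
  have hSm := Finset.card_filter_add_card_filter_not (s := triComps G (farIn G U v)) (Splits G A)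
  have hTm := Finset.card_filter_add_card_filter_not (s := triComps G (farIn G U v)) (Splits G B)
  have hm := Finset.card_union_add_card_inter
    ((triComps G (farIn G U v)).filter (Splits G A))
    ((triComps G (farIn G U v)).filter (Splits G B))
  rw [← Finset.filter_or, ← Finset.filter_and, Finset.filter_true_of_mem hcov] at hm
  rcases le_total S.card T.card with h | h
  · exact ⟨S, hSU, hvS, hSr, by omega⟩
  · exact ⟨T, hTU, hvT, hTr, by omega⟩

/-- A triangle component of `G[farIn G U v]` has a neighbour in the neighbourhood of `v`. -/
lemma exists_adj_of_mem_triComps {U X : Finset α} {v : α} (hc : ConnectedOn G U) (hv : v ∈ U)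
    (hX : X ∈ triComps G (farIn G U v)) : ∃ y ∈ nbrIn G U v, ∃ x ∈ X, G.Adj y x := by
  obtain ⟨hXR, ⟨hX3, -⟩, hout⟩ := mem_triComps.mp hX
  obtain ⟨x, hx, y, hy, hyX, hxy⟩ := hc X (hXR.trans (farIn_ssubset hv).subset)
    (Finset.card_pos.mp (by omega)) (by
      rintro rfl
      simpa [mem_farIn] using hXR hv)
  have hxR := mem_farIn.mp (hXR hx)
  have hyv : y ≠ v := by
    rintro rfl
    exact hxR.2.2 hxy.symm
  refine ⟨y, mem_nbrIn.mpr ⟨hy, ?_⟩, x, hx, hxy.symm⟩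
  by_contra hvy
  exact hout x hx y (mem_farIn.mpr ⟨hy, hyv, hvy⟩) hyX hxy

lemma splits_or_splits_sdiff (h4 : NoFourClique G) {U B X : Finset α} {v : α}
    (hc : ConnectedOn G U) (hv : v ∈ U) (hX : X ∈ triComps G (farIn G U v)) :
    Splits G B X ∨ Splits G (nbrIn G U v \ B) X := by
  obtain ⟨y, hy, x, hx, hyx⟩ := exists_adj_of_mem_triComps hc hv hX
  have hXt := (mem_triComps.mp hX).2.1
  by_cases hyB : y ∈ B
  · exact Or.inl (splits_of_adj h4 hXt hyB hx hyx)
  · exact Or.inr (splits_of_adj h4 hXt (by simp [hy, hyB]) hx hyx)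

lemma card_add_card_sdiff {A B : Finset α} (h : A ⊆ B) : A.card + (B \ A).card = B.card := by
  have := Finset.card_sdiff_add_card_eq_card h
  omega

/-- A resolving set through a prescribed vertex. -/
lemma exists_resolvesOn_mem (h4 : NoFourClique G) {U : Finset α} {v : α} (hc : ConnectedOn G U)
    (hv : v ∈ U) (hR : HalfBound G (farIn G U v)) :
    ∃ S ⊆ U, v ∈ S ∧ ResolvesOn G U S ∧ 2 * S.card ≤ U.card + 1 := by
  obtain ⟨B, hB, -, -, hBr, hBr'⟩ := exists_resolvesOn_pair (I := ∅) v
    (nbrIn_triangleFree h4 (U := U) (v := v)) (by simp) (by simp)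
  obtain ⟨S, hSU, hvS, hSr, hS⟩ := exists_resolvesOn_of_pair hv hR hB Finset.sdiff_subset hBr hBr'
    fun X hX => splits_or_splits_sdiff h4 hc hv hX
  refine ⟨S, hSU, hvS, hSr, ?_⟩
  have := card_add_card_sdiff hB
  have := card_eq_nbrIn_add_farIn (G := G) hv
  omega

open Classical in
/-- If a triangle component of `G[farIn G U v]` is attached at two vertices, there is a small
resolving set. -/
lemma exists_resolvesOn_of_two_attachments (h4 : NoFourClique G) {U X : Finset α} {v y z x t : α}
    (hc : ConnectedOn G U) (hv : v ∈ U) (hR : HalfBound G (farIn G U v))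
    (hX : X ∈ triComps G (farIn G U v)) (hy : y ∈ nbrIn G U v) (hz : z ∈ nbrIn G U v)
    (hyz : y ≠ z) (hx : x ∈ X) (hyx : G.Adj y x) (ht : t ∈ X) (hzt : G.Adj z t) :
    ∃ S ⊆ U, ResolvesOn G U S ∧ 2 * S.card ≤ U.card := by
  obtain ⟨B, hB, hyB, hzB, hBr, hBr'⟩ := exists_resolvesOn_pair (I := {y}) z
    (nbrIn_triangleFree h4 (U := U) (v := v)) (by simp [hy, hyz]) (by simp)
  obtain ⟨S, hSU, hvS, hSr, hS⟩ := exists_resolvesOn_of_pair hv hR hB Finset.sdiff_subset hBr hBr'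
    fun X hX => splits_or_splits_sdiff h4 hc hv hX
  refine ⟨S, hSU, hSr, ?_⟩
  have := card_add_card_sdiff hB
  have := card_eq_nbrIn_add_farIn (G := G) hv
  have hXt := (mem_triComps.mp hX).2.1
  have : 0 < ((triComps G (farIn G U v)).filter fun X =>
      Splits G B X ∧ Splits G (nbrIn G U v \ B) X).card := Finset.card_pos.mpr ⟨X, by
    rw [Finset.mem_filter]
    exact ⟨hX, splits_of_adj h4 hXt (hyB (by simp)) hx hyx,
      splits_of_adj h4 hXt (by simp [hz, hzB]) ht hzt⟩⟩
  omega

/-- Removing a triangle that hangs at a single vertex. -/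
lemma exists_resolvesOn_of_hanging (h4 : NoFourClique G) {U X : Finset α} {y x : α}
    (hc : ConnectedOn G U) (hodd : U.card % 2 = 1) (ih : ∀ W ⊂ U, HalfBound G W)
    (hXU : X ⊆ U) (hX : IsTriangle G X) (hy : y ∈ U) (hyX : y ∉ X) (hx : x ∈ X)
    (hyx : G.Adj y x)
    (hout : ∀ a ∈ X, ∀ b ∈ U, b ∉ X → G.Adj a b → b = y) :
    ∃ S ⊆ U, ResolvesOn G U S ∧ 2 * S.card ≤ U.card := by
  have hyH : y ∈ U \ X := by simp [hy, hyX]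
  have hcH : ConnectedOn G (U \ X) := by
    have key : ∀ P ⊆ U \ X, y ∉ P → P.Nonempty → ∃ p ∈ P, ∃ q ∈ U \ X, q ∉ P ∧ G.Adj p q := by
      intro P hP hyP hne
      obtain ⟨p, hp, q, hq, hqP, hpq⟩ := hc P (hP.trans Finset.sdiff_subset) hne
        (fun h => hyP (h ▸ hy))
      refine ⟨p, hp, q, ?_, hqP, hpq⟩
      have hpX := Finset.mem_sdiff.mp (hP hp)
      refine Finset.mem_sdiff.mpr ⟨hq, fun hqX => ?_⟩
      exact hyP (hout q hqX p hpX.1 hpX.2 hpq.symm ▸ hp)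
    intro P hP hne hneq
    by_cases hyP : y ∈ P
    · obtain ⟨p, hp, q, hq, hqP, hpq⟩ := key ((U \ X) \ P) Finset.sdiff_subset (by simp [hyP])
        (Finset.sdiff_nonempty.mpr fun h => hneq (hP.antisymm h))
      have hp' := Finset.mem_sdiff.mp hp
      refine ⟨q, ?_, p, hp'.1, hp'.2, hpq.symm⟩
      by_contra hqP'
      exact hqP (Finset.mem_sdiff.mpr ⟨hq, hqP'⟩)
    · exact key P hP hyP hne
  obtain ⟨S, hSH, hyS, hSr, hS⟩ := exists_resolvesOn_mem h4 hcH hyH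
    (ih _ ((farIn_ssubset hyH).trans_subset Finset.sdiff_subset))
  obtain ⟨p, hp, hpr⟩ := exists_resolvesOn_of_splits (C := S) hX (splits_of_adj h4 hX hyS hx hyx)
  have hcard := card_add_card_sdiff hXU
  refine ⟨S ∪ {p}, ?_, ?_, ?_⟩
  · exact Finset.union_subset (hSH.trans Finset.sdiff_subset) (by simpa using hXU hp)
  · intro a ha b hb hab haS hbS
    by_cases haX : a ∈ X <;> by_cases hbX : b ∈ X
    · exact hpr a haX b hbX hab haS hbS
    · exact absurd (by simp [hout a haX b hb hbX hab, hyS]) hbS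
    · exact absurd (by simp [hout b hbX a ha haX hab.symm, hyS]) haS
    · exact hSr.mono Finset.subset_union_left a (by simp [ha, haX]) b (by simp [hb, hbX]) hab
        haS hbS
  · have h1 := Finset.card_union_le S {p}
    have h2 := hX.1
    rw [Finset.card_singleton] at h1
    omega

/-- If `G[N(v)]` is not a perfect matching, there is a small resolving set. -/
lemma exists_resolvesOn_of_not_matching (h4 : NoFourClique G) {U : Finset α} {v u : α}
    (hv : v ∈ U) (hR : HalfBound G (farIn G U v)) (hT : triComps G (farIn G U v) = ∅)
    (hu : u ∈ nbrIn G U v) (hcard : (nbrIn G (nbrIn G U v) u).card ≠ 1) :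
    ∃ S ⊆ U, ResolvesOn G U S ∧ 2 * S.card ≤ U.card := by
  have hn := card_eq_nbrIn_add_farIn (G := G) hv
  have htf := nbrIn_triangleFree h4 (U := U) (v := v)
  set N := nbrIn G U v
  obtain ⟨A, B, hA, hB, hAr, hBr, hAB⟩ : ∃ A B : Finset α, A ⊆ N ∧ B ⊆ N ∧ ResolvesOn G N A ∧
      ResolvesOn G N B ∧ A.card + B.card < N.card := by
    rcases Nat.eq_zero_or_pos (nbrIn G N u).card with h0 | hpos
    · have h0' : ∀ w ∈ N, ¬G.Adj u w := by
        intro w hw huw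
        rw [Finset.card_eq_zero] at h0
        simpa [h0] using mem_nbrIn.mpr ⟨hw, huw⟩
      have hsub : N.erase u ⊆ N := Finset.erase_subset _ _
      obtain ⟨B, hB, -, -, hBr, hBr'⟩ := exists_resolvesOn_pair (W := N.erase u) (I := ∅) v
        (fun a ha b hb c hc => htf a (hsub ha) b (hsub hb) c (hsub hc)) (by simp) (by simp)
      have lift : ∀ A, ResolvesOn G (N.erase u) A → ResolvesOn G N A := by
        intro A hA a ha b hb hab
        refine hA a ?_ b ?_ hab
        · refine Finset.mem_erase.mpr ⟨?_, ha⟩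
          rintro rfl
          exact h0' b hb hab
        · refine Finset.mem_erase.mpr ⟨?_, hb⟩
          rintro rfl
          exact h0' a ha hab.symm
      refine ⟨B, N.erase u \ B, hB.trans hsub, Finset.sdiff_subset.trans hsub, lift _ hBr,
        lift _ hBr', ?_⟩
      rw [card_add_card_sdiff hB, Finset.card_erase_of_mem hu]
      have := Finset.card_pos.mpr ⟨u, hu⟩
      omega
    · have hsub : farIn G N u ⊆ N := (farIn_ssubset hu).subset
      obtain ⟨B, hB, -, -, hBr, hBr'⟩ := exists_resolvesOn_pair (W := farIn G N u) (I := ∅) v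
        (fun a ha b hb c hc => htf a (hsub ha) b (hsub hb) c (hsub hc)) (by simp) (by simp)
      have lift : ∀ A, ResolvesOn G (farIn G N u) A → ResolvesOn G N (insert u A) := by
        intro A hA a ha b hb hab haA hbA
        have hau : a ≠ u := fun h => haA (by simp [h])
        have hbu : b ≠ u := fun h => hbA (by simp [h])
        by_cases h : G.Adj u a ↔ G.Adj u b
        · by_cases hua : G.Adj u a
          · exact absurd hab (htf u hu a ha b hb hua (h.mp hua))
          · exact hA.mono (Finset.subset_insert _ _) a (mem_farIn.mpr ⟨ha, hau, hua⟩) b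
              (mem_farIn.mpr ⟨hb, hbu, fun h' => hua (h.mpr h')⟩) hab haA hbA
        · exact ⟨u, by simp, h⟩
      refine ⟨insert u B, insert u (farIn G N u \ B), ?_, ?_, lift _ hBr, lift _ hBr', ?_⟩
      · exact Finset.insert_subset hu (hB.trans hsub)
      · exact Finset.insert_subset hu (Finset.sdiff_subset.trans hsub)
      · have h1 := Finset.card_insert_le u B
        have h2 := Finset.card_insert_le u (farIn G N u \ B)
        have h3 := card_add_card_sdiff hB
        have h4 := card_eq_nbrIn_add_farIn (G := G) hu
        omega
  obtain ⟨S, hSU, -, hSr, hS⟩ := exists_resolvesOn_of_pair hv hR hA hB hAr hBr (by simp [hT])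
  exact ⟨S, hSU, hSr, by omega⟩

/-- If all neighbourhoods induce perfect matchings and `v` has at least three neighbours, there is a
small resolving set not containing `v`. -/
lemma exists_resolvesOn_of_matching {U R : Finset α} {v u₁ u₂ u₃ : α}
    (hex : ∀ v ∈ U, ∀ a ∈ U, G.Adj v a → ∃ b ∈ U, G.Adj v b ∧ G.Adj a b)
    (huniq : ∀ v ∈ U, ∀ a ∈ U, ∀ b ∈ U, ∀ c ∈ U, G.Adj v a → G.Adj v b → G.Adj v c →
      G.Adj a b → G.Adj a c → b = c)
    (hv : v ∈ U) (hR : R ⊆ farIn G U v) (hRr : ResolvesOn G (farIn G U v) R)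
    (hRc : 2 * R.card ≤ (farIn G U v).card)
    (hu₁ : u₁ ∈ nbrIn G U v) (hu₂ : u₂ ∈ nbrIn G U v) (hu₃ : u₃ ∈ nbrIn G U v)
    (h₁₂ : u₁ ≠ u₂) (h₁₃ : u₁ ≠ u₃) (h₂₃ : u₂ ≠ u₃) :
    ∃ S ⊆ U, ResolvesOn G U S ∧ 2 * S.card ≤ U.card := by
  have hn := card_eq_nbrIn_add_farIn (G := G) hv
  obtain ⟨A, hAN, hAc, hind, hdom⟩ : ∃ A ⊆ nbrIn G U v, 2 * A.card ≤ (nbrIn G U v).card ∧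
      (∀ a ∈ nbrIn G U v, ∀ b ∈ nbrIn G U v, a ∉ A → b ∉ A → ¬G.Adj a b) ∧
      ∀ a ∈ nbrIn G U v, a ∉ A → ∃ b ∈ A, G.Adj a b := by
    obtain ⟨B, hB, -, -, hind, hdom⟩ := exists_maximal_independent (G := G) (nbrIn G U v) ∅ v
      (by simp) (by simp)
    have hdom' : ∀ a ∈ nbrIn G U v, a ∉ B → ∃ b ∈ B, G.Adj a b := by
      intro a ha
      refine hdom a ha ?_
      rintro rfl
      exact G.loopless.irrefl _ (mem_nbrIn.mp ha).2
    have hcard := card_add_card_sdiff hB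
    by_cases hle : 2 * B.card ≤ (nbrIn G U v).card
    · refine ⟨B, hB, hle, ?_, hdom'⟩
      intro a ha b hb haB hbB hab
      obtain ⟨c, hc, hac⟩ := hdom' a ha haB
      have ha' := mem_nbrIn.mp ha
      have hb' := mem_nbrIn.mp hb
      have hc' := mem_nbrIn.mp (hB hc)
      exact hbB (huniq v hv a ha'.1 b hb'.1 c hc'.1 ha'.2 hb'.2 hc'.2 hab hac ▸ hc)
    · refine ⟨nbrIn G U v \ B, Finset.sdiff_subset, by omega, ?_, ?_⟩
      · intro a ha b hb haB hbB
        exact hind a (by simpa [ha] using haB) b (by simpa [hb] using hbB)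
      · intro a ha haB
        replace haB : a ∈ B := by simpa [ha] using haB
        have ha' := mem_nbrIn.mp ha
        obtain ⟨b, hb, hvb, hab⟩ := hex v hv a ha'.1 ha'.2
        exact ⟨b, Finset.mem_sdiff.mpr ⟨mem_nbrIn.mpr ⟨hb, hvb⟩, fun hbB => hind a haB b hbB hab⟩,
          hab⟩
  have hcenter : ∀ u ∈ nbrIn G U v, u ∉ A → ∃ a ∈ A, ¬(G.Adj a v ↔ G.Adj a u) := by
    intro u hu huA
    obtain ⟨a, ha, hua⟩ := hdom u hu huA
    obtain ⟨z, hz, hzu, hza⟩ : ∃ z ∈ nbrIn G U v, z ≠ u ∧ z ≠ a := by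
      by_cases h1 : u₁ ≠ u ∧ u₁ ≠ a
      · exact ⟨u₁, hu₁, h1⟩
      by_cases h2 : u₂ ≠ u ∧ u₂ ≠ a
      · exact ⟨u₂, hu₂, h2⟩
      exact ⟨u₃, hu₃, by grind, by grind⟩
    have hu' := mem_nbrIn.mp hu
    have ha' := mem_nbrIn.mp (hAN ha)
    obtain ⟨b, hb, hbu, hba⟩ : ∃ b ∈ A, b ≠ u ∧ b ≠ a := by
      by_cases hzA : z ∈ A
      · exact ⟨z, hzA, hzu, hza⟩
      · obtain ⟨b, hb, hzb⟩ := hdom z hz hzA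
        have hz' := mem_nbrIn.mp hz
        refine ⟨b, hb, fun h => huA (h ▸ hb), ?_⟩
        rintro rfl
        exact hzu (huniq v hv b ha'.1 z hz'.1 u hu'.1 ha'.2 hz'.2 hu'.2 hzb.symm hua.symm)
    have hb' := mem_nbrIn.mp (hAN hb)
    exact ⟨b, hb, fun h => hba (huniq v hv u hu'.1 b hb'.1 a ha'.1 hu'.2 hb'.2 ha'.2
      (h.mp hb'.2.symm).symm hua)⟩
  have hcross : ∀ u ∈ nbrIn G U v, u ∉ A → ∀ r ∈ farIn G U v, G.Adj u r →
      ∃ a ∈ A, ¬(G.Adj a u ↔ G.Adj a r) := by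
    intro u hu huA r hr hur
    obtain ⟨a, ha, hua⟩ := hdom u hu huA
    have hu' := mem_nbrIn.mp hu
    have ha' := mem_nbrIn.mp (hAN ha)
    have hr' := mem_farIn.mp hr
    exact ⟨a, ha, fun h => hr'.2.1 (huniq u hu'.1 a ha'.1 r hr'.1 v hv hua hur hu'.2.symm
      (h.mp hua.symm) ha'.2.symm)⟩
  refine ⟨A ∪ R, ?_, ?_, ?_⟩
  · exact Finset.union_subset (fun x hx => (mem_nbrIn.mp (hAN hx)).1)
      (hR.trans (farIn_ssubset hv).subset)
  · have hside : ∀ x ∈ U, x = v ∨ x ∈ nbrIn G U v ∨ x ∈ farIn G U v := by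
      intro x hx
      rw [mem_nbrIn, mem_farIn]
      tauto
    have hfar : ∀ r ∈ farIn G U v, ¬G.Adj v r := fun r hr => (mem_farIn.mp hr).2.2
    intro a ha b hb hab haS hbS
    have haA : a ∉ A := fun h => haS (Finset.mem_union_left _ h)
    have hbA : b ∉ A := fun h => hbS (Finset.mem_union_left _ h)
    have lift : (∃ w ∈ A, ¬(G.Adj w a ↔ G.Adj w b)) → ∃ w ∈ A ∪ R, ¬(G.Adj w a ↔ G.Adj w b) :=
      fun ⟨w, hw, h⟩ => ⟨w, Finset.mem_union_left _ hw, h⟩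
    rcases hside a ha with rfl | haN | haR <;> rcases hside b hb with rfl | hbN | hbR
    · exact absurd rfl hab.ne
    · exact lift (hcenter b hbN hbA)
    · exact absurd hab (hfar b hbR)
    · obtain ⟨w, hw, h⟩ := hcenter a haN haA
      exact lift ⟨w, hw, fun h' => h h'.symm⟩
    · exact absurd hab (hind a haN b hbN haA hbA)
    · exact lift (hcross a haN haA b hbR hab)
    · exact absurd hab.symm (hfar a haR)
    · obtain ⟨w, hw, h⟩ := hcross b hbN hbA a haR hab.symm
      exact lift ⟨w, hw, fun h' => h h'.symm⟩
    · exact hRr.mono Finset.subset_union_right a haR b hbR hab haS hbS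
  · have := Finset.card_union_le A R
    omega

/-- The inductive step for connected graphs other than the triangle. -/
lemma exists_resolvesOn_of_connectedOn (h4 : NoFourClique G) {U : Finset α}
    (hc : ConnectedOn G U) (hU : ¬IsTriangle G U) (ih : ∀ W ⊂ U, HalfBound G W) :
    ∃ S ⊆ U, ResolvesOn G U S ∧ 2 * S.card ≤ U.card := by
  by_contra hcon
  have hodd : U.card % 2 = 1 := by
    rcases U.eq_empty_or_nonempty with rfl | ⟨v, hv⟩
    · exact absurd ⟨∅, subset_rfl, by simp [ResolvesOn], by simp⟩ hcon
    · obtain ⟨S, hSU, -, hSr, hS⟩ := exists_resolvesOn_mem h4 hc hv (ih _ (farIn_ssubset hv))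
      by_contra
      exact hcon ⟨S, hSU, hSr, by omega⟩
  have hT : ∀ v ∈ U, triComps G (farIn G U v) = ∅ := by
    intro v hv
    rw [Finset.eq_empty_iff_forall_notMem]
    intro X hX
    obtain ⟨y, hy, x, hx, hyx⟩ := exists_adj_of_mem_triComps hc hv hX
    obtain ⟨hXR, hXt, hout⟩ := mem_triComps.mp hX
    refine hcon (exists_resolvesOn_of_hanging (y := y) h4 hc hodd ih
      (hXR.trans (farIn_ssubset hv).subset) hXt (mem_nbrIn.mp hy).1 ?_ hx hyx ?_)
    · exact fun hyX => (mem_farIn.mp (hXR hyX)).2.2 (mem_nbrIn.mp hy).2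
    · intro a ha b hb hbX hab
      by_contra hby
      have hva := (mem_farIn.mp (hXR ha)).2.2
      have hbN : b ∈ nbrIn G U v := by
        refine mem_nbrIn.mpr ⟨hb, ?_⟩
        by_contra hvb
        refine hout a ha b (mem_farIn.mpr ⟨hb, ?_, hvb⟩) hbX hab
        rintro rfl
        exact hva hab.symm
      exact hcon (exists_resolvesOn_of_two_attachments h4 hc hv (ih _ (farIn_ssubset hv)) hX hy hbN
        (Ne.symm hby) hx hyx ha hab.symm)
  have hmatch : ∀ v ∈ U, ∀ u ∈ nbrIn G U v, (nbrIn G (nbrIn G U v) u).card = 1 := by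
    intro v hv u hu
    by_contra hne
    exact hcon (exists_resolvesOn_of_not_matching h4 hv (ih _ (farIn_ssubset hv)) (hT v hv) hu hne)
  have hex : ∀ v ∈ U, ∀ a ∈ U, G.Adj v a → ∃ b ∈ U, G.Adj v b ∧ G.Adj a b := by
    intro v hv a ha hva
    obtain ⟨b, hb⟩ := Finset.card_pos.mp
      (by rw [hmatch v hv a (mem_nbrIn.mpr ⟨ha, hva⟩)]; exact one_pos)
    simp only [mem_nbrIn] at hb
    exact ⟨b, hb.1.1, hb.1.2, hb.2⟩
  have huniq : ∀ v ∈ U, ∀ a ∈ U, ∀ b ∈ U, ∀ c ∈ U, G.Adj v a → G.Adj v b → G.Adj v c →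
      G.Adj a b → G.Adj a c → b = c := by
    intro v hv a ha b hb c hc hva hvb hvc hab hac
    exact Finset.card_le_one.mp (hmatch v hv a (mem_nbrIn.mpr ⟨ha, hva⟩)).le b
      (by simp [mem_nbrIn, *]) c (by simp [mem_nbrIn, *])
  have hbig : ∀ v ∈ U, ∀ a ∈ U, ∀ b ∈ U, ∀ c ∈ U, G.Adj v a → G.Adj v b → G.Adj v c →
      a ≠ b → a ≠ c → b ≠ c → False := by
    intro v hv a ha b hb c hc hva hvb hvc hab hac hbc
    obtain ⟨R, hR, hRr, hRc⟩ := ih _ (farIn_ssubset (G := G) hv) ∅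
    rw [Finset.empty_union] at hRr
    simp only [hT v hv, Finset.filter_empty, Finset.card_empty, add_zero] at hRc
    exact hcon (exists_resolvesOn_of_matching hex huniq hv hR hRr hRc
      (mem_nbrIn.mpr ⟨ha, hva⟩) (mem_nbrIn.mpr ⟨hb, hvb⟩) (mem_nbrIn.mpr ⟨hc, hvc⟩) hab hac hbc)
  obtain ⟨v, hv⟩ : U.Nonempty := Finset.card_pos.mp (by omega)
  by_cases hUv : U = {v}
  · refine hcon ⟨∅, by simp, ?_, by simp⟩
    intro a ha b hb hab
    rw [hUv, Finset.mem_singleton] at ha hb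
    exact absurd (ha.trans hb.symm) hab.ne
  obtain ⟨v', hv', a, ha, -, hva⟩ := hc {v} (by simpa using hv) (by simp) (Ne.symm hUv)
  obtain rfl := Finset.mem_singleton.mp hv'
  obtain ⟨b, hb, hvb, hab⟩ := hex v' hv a ha hva
  have htri : IsTriangle G {v', a, b} := by
    refine ⟨Finset.card_eq_three.mpr ⟨v', a, b, hva.ne, hvb.ne, hab.ne, rfl⟩, ?_⟩
    simp only [Finset.mem_insert, Finset.mem_singleton]
    rintro x (rfl | rfl | rfl) y (rfl | rfl | rfl) hxy <;>
      first | exact absurd rfl hxy | assumption | (apply SimpleGraph.Adj.symm; assumption)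
  obtain ⟨p, hp, z, hz, hzt, hpz⟩ := hc {v', a, b}
    (by simp [Finset.insert_subset_iff, hv, ha, hb]) (by simp) (fun h => hU (h ▸ htri))
  simp only [Finset.mem_insert, Finset.mem_singleton, not_or] at hp hzt
  rcases hp with rfl | rfl | rfl
  · exact hbig _ hv a ha b hb z hz hva hvb hpz hab.ne (Ne.symm hzt.2.1) (Ne.symm hzt.2.2)
  · exact hbig _ ha v' hv b hb z hz hva.symm hab hpz hvb.ne (Ne.symm hzt.1) (Ne.symm hzt.2.2)
  · exact hbig _ hb v' hv a ha z hz hvb.symm hab.symm hpz hva.ne (Ne.symm hzt.1) (Ne.symm hzt.2.1)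

lemma triComps_eq_empty {U : Finset α} (hc : ConnectedOn G U) (hU : ¬IsTriangle G U) :
    triComps G U = ∅ := by
  rw [Finset.eq_empty_iff_forall_notMem]
  intro X hX
  obtain ⟨hXU, hXt, hout⟩ := mem_triComps.mp hX
  obtain ⟨x, hx, y, hy, hyX, hxy⟩ := hc X hXU (Finset.card_pos.mp (by have := hXt.1; omega))
    (fun h => hU (h ▸ hXt))
  exact hout x hx y hy hyX hxy

lemma triComps_eq_singleton {U : Finset α} (hU : IsTriangle G U) : triComps G U = {U} := by
  ext X
  rw [mem_triComps, Finset.mem_singleton]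
  constructor
  · rintro ⟨hXU, hX, -⟩
    exact Finset.eq_of_subset_of_card_le hXU (by rw [hX.1, hU.1])
  · rintro rfl
    exact ⟨subset_rfl, hU, fun _ _ y hy hy' => absurd hy hy'⟩

lemma triComps_sdiff_union {U P : Finset α} (hP : P ⊆ U)
    (hno : ∀ x ∈ P, ∀ y ∈ U, y ∉ P → ¬G.Adj x y) :
    triComps G U = triComps G P ∪ triComps G (U \ P) := by
  ext X
  simp only [Finset.mem_union, mem_triComps]
  constructor
  · rintro ⟨hXU, hX, hout⟩
    by_cases hXP : ∃ x ∈ X, x ∈ P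
    · obtain ⟨x, hx, hxP⟩ := hXP
      refine Or.inl ⟨fun y hy => ?_, hX, fun a ha b hb => hout a ha b (hP hb)⟩
      by_contra hyP
      exact hno x hxP y (hXU hy) hyP (hX.2 x hx y hy (fun h => hyP (h ▸ hxP)))
    · push Not at hXP
      exact Or.inr ⟨fun y hy => Finset.mem_sdiff.mpr ⟨hXU hy, hXP y hy⟩, hX,
        fun a ha b hb => hout a ha b (Finset.mem_sdiff.mp hb).1⟩
  · rintro (⟨hXP, hX, hout⟩ | ⟨hXP, hX, hout⟩)
    · refine ⟨hXP.trans hP, hX, fun a ha b hb hbX => ?_⟩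
      by_cases hbP : b ∈ P
      · exact hout a ha b hbP hbX
      · exact hno a (hXP ha) b hb hbP
    · refine ⟨hXP.trans Finset.sdiff_subset, hX, fun a ha b hb hbX hab => ?_⟩
      have ha' := Finset.mem_sdiff.mp (hXP ha)
      by_cases hbP : b ∈ P
      · exact hno b hbP a ha'.1 ha'.2 hab.symm
      · exact hout a ha b (Finset.mem_sdiff.mpr ⟨hb, hbP⟩) hbX hab

lemma disjoint_triComps_sdiff {U P : Finset α} :
    Disjoint (triComps G P) (triComps G (U \ P)) := by
  rw [Finset.disjoint_left]
  intro X h1 h2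
  obtain ⟨x, hx⟩ := Finset.card_pos.mp (by have := (mem_triComps.mp h1).2.1.1; omega : 0 < X.card)
  exact (Finset.mem_sdiff.mp ((mem_triComps.mp h2).1 hx)).2 ((mem_triComps.mp h1).1 hx)

lemma HalfBound.of_disconnected {U P : Finset α} (hP : P ⊆ U)
    (hno : ∀ x ∈ P, ∀ y ∈ U, y ∉ P → ¬G.Adj x y) (h₁ : HalfBound G P)
    (h₂ : HalfBound G (U \ P)) : HalfBound G U := by
  classical
  intro C
  obtain ⟨S, hSP, hSr, hS⟩ := h₁ C
  obtain ⟨T, hTP, hTr, hT⟩ := h₂ C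
  refine ⟨S ∪ T, Finset.union_subset (hSP.trans hP) (hTP.trans Finset.sdiff_subset), ?_, ?_⟩
  · intro a ha b hb hab haS hbS
    by_cases haP : a ∈ P <;> by_cases hbP : b ∈ P
    · exact hSr.mono (by grind) a haP b hbP hab haS hbS
    · exact absurd hab (hno a haP b hb hbP)
    · exact absurd hab.symm (hno b hbP a ha haP)
    · exact hTr.mono (by grind) a (by simp [ha, haP]) b (by simp [hb, hbP]) hab haS hbS
  · have h3 := Finset.card_union_le S T
    have h4 := card_add_card_sdiff hP
    have hd := disjoint_triComps_sdiff (G := G) (U := U) (P := P)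
    rw [triComps_sdiff_union hP hno, Finset.filter_union, Finset.filter_union,
      Finset.card_union_of_disjoint (Finset.disjoint_filter_filter hd),
      Finset.card_union_of_disjoint (Finset.disjoint_filter_filter hd)]
    omega

lemma HalfBound.of_isTriangle {U : Finset α} (hU : IsTriangle G U) : HalfBound G U := by
  classical
  intro C
  have hcard := hU.1
  rw [triComps_eq_singleton hU, Finset.filter_singleton, Finset.filter_singleton]
  by_cases hs : Splits G C U
  · obtain ⟨p, hp, hpr⟩ := exists_resolvesOn_of_splits hU hs
    exact ⟨{p}, by simpa using hp, hpr, by simp [hs, hcard]⟩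
  · obtain ⟨p, hp⟩ := Finset.card_pos.mp (by omega : 0 < U.card)
    refine ⟨U.erase p, Finset.erase_subset _ _, ?_, by simp [hs, hcard, hp]⟩
    intro a ha b hb hab haS hbS
    simp only [Finset.mem_union, Finset.mem_erase, not_or, not_and_or, not_not] at haS hbS
    have := hab.ne
    grind

/-- A graph without 4-cliques satisfies the half bound. -/
theorem NoFourClique.halfBound (h4 : NoFourClique G) (U : Finset α) : HalfBound G U := by
  classical
  induction U using Finset.strongInduction with
  | H U ih =>
    by_cases hU : IsTriangle G U
    · exact .of_isTriangle hU
    by_cases hc : ConnectedOn G U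
    · obtain ⟨S, hSU, hSr, hS⟩ := exists_resolvesOn_of_connectedOn h4 hc hU ih
      intro C
      refine ⟨S, hSU, hSr.mono Finset.subset_union_right, ?_⟩
      simpa [triComps_eq_empty hc hU] using hS
    · simp only [ConnectedOn, not_forall] at hc
      obtain ⟨P, hP, ⟨x, hx⟩, hne, hno⟩ := hc
      push Not at hno
      refine .of_disconnected hP hno (ih P (hP.ssubset_of_ne hne)) (ih _ ?_)
      exact Finset.sdiff_ssubset hP ⟨x, hx⟩

omit [DecidableEq α] in
lemma noFourClique_of_cliqueFree (h : G.CliqueFree 4) : NoFourClique G := by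
  classical
  intro a b c d hab hac had hbc hbd hcd
  exact h {a, b, c, d} ((SimpleGraph.is3Clique_triple_iff.mpr ⟨hbc, hbd, hcd⟩).insert
    (by simp [hab, hac, had]))

lemma connectedOn_univ [Fintype α] (hc : G.Connected) : ConnectedOn G Finset.univ := by
  rintro P - ⟨x, hx⟩ hne
  obtain ⟨y, hy⟩ : ∃ y, y ∉ P := by
    by_contra! h
    exact hne (Finset.eq_univ_of_forall h)
  obtain ⟨w⟩ := hc.preconnected x y
  obtain ⟨d, -, h1, h2⟩ := w.exists_boundary_dart (P : Set α) hx hy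
  exact ⟨d.fst, h1, d.snd, Finset.mem_univ _, h2, d.adj⟩

end

theorem dimAL_le_half (G : SimpleGraph V) (hc : G.Connected)
    (hn : 4 ≤ Fintype.card V) (hω : G.cliqueNum = 3) :
    dimAL G ≤ Fintype.card V / 2 := by
  have hfree : G.CliqueFree 4 := by
    intro s hs
    have := hs.isClique.card_le_cliqueNum
    rw [hω, hs.card_eq] at this
    omega
  have h4 := noFourClique_of_cliqueFree hfree
  obtain ⟨S, -, hSr, hS⟩ := exists_resolvesOn_of_connectedOn h4 (connectedOn_univ hc)
    (fun h => by have := h.1; rw [Finset.card_univ] at this; omega) fun W _ => h4.halfBound W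
  rw [Finset.card_univ] at hS
  have hres : IsLocalAdjResolving G S := by
    intro u v huv hu hv
    obtain ⟨w, hw, hne⟩ := hSr u (Finset.mem_univ _) v (Finset.mem_univ _) huv hu hv
    exact ⟨w, hw, (xor_iff_not_iff _ _).mpr hne⟩
  have : dimAL G ≤ S.card := Nat.sInf_le ⟨S, rfl, hres⟩
  omega
end

section
/- If G is a finite simple connected graph with n(G) ≥ 5 and clique number ω(G) = 4, then dim_l(G) ≤ ⌊(2/3)·n(G)⌋. -/
open SimpleGraph

variable {V : Type*} [Fintype V] [DecidableEq V]

/-- The edge `u v` lies inside a colour class of `c` and no vertex of another colour is adjacent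
to exactly one of its ends. -/
def Unseparated (G : SimpleGraph V) (c : V → Fin 3) (u v : V) : Prop :=
  G.Adj u v ∧ c u = c v ∧ ∀ z, c z ≠ c u → (G.Adj z u ↔ G.Adj z v)

/-- No colouring has a strictly smaller set of unseparated edges than `c`. -/
def IsMinimalColoring (G : SimpleGraph V) (c : V → Fin 3) : Prop :=
  ∀ c', (∀ a b, Unseparated G c' a b → Unseparated G c a b) →
    ∀ a b, Unseparated G c a b → Unseparated G c' a b

theorem Unseparated.symm {G : SimpleGraph V} {c : V → Fin 3} {u v : V}
    (h : Unseparated G c u v) : Unseparated G c v u :=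
  ⟨h.1.symm, h.2.1.symm, fun z hz => (h.2.2 z (h.2.1 ▸ hz)).symm⟩

theorem exists_isMinimalColoring (G : SimpleGraph V) : ∃ c, IsMinimalColoring G c := by
  classical
  let f : (V → Fin 3) → Finset (V × V) := fun c =>
    Finset.univ.filter fun p => Unseparated G c p.1 p.2
  obtain ⟨c, -, hc⟩ := Finset.exists_min_image Finset.univ (fun c => (f c).card)
    ⟨fun _ => 0, Finset.mem_univ _⟩
  refine ⟨c, fun c' h a b hab => ?_⟩
  have hsub : f c' ⊆ f c := fun p hp => by
    simp only [f, Finset.mem_filter, Finset.mem_univ, true_and] at hp ⊢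
    exact h _ _ hp
  have heq := Finset.eq_of_subset_of_card_le hsub (hc c' (Finset.mem_univ _))
  have hmem : (a, b) ∈ f c := by simpa [f] using hab
  rw [← heq] at hmem
  simpa [f] using hmem

/-- Recolouring an end of an unseparated edge must create a new unseparated edge. -/
theorem IsMinimalColoring.exists_of_recolor {G : SimpleGraph V} {c : V → Fin 3}
    (hc : IsMinimalColoring G c) {u v : V} (huv : Unseparated G c u v) {j : Fin 3}
    (hj : j ≠ c u) :
    ∃ w, c w = j ∧ G.Adj u w ∧ ∀ z, c z ≠ j → z ≠ u → (G.Adj z u ↔ G.Adj z w) := by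
  by_contra hno
  have hleft : ∀ b, ¬ Unseparated G (Function.update c u j) u b := by
    rintro b ⟨hab, hcol, hsep⟩
    have hb : b ≠ u := hab.ne'
    rw [Function.update_self, Function.update_of_ne hb] at hcol
    refine hno ⟨b, hcol.symm, hab, fun z hz hzu => hsep z ?_⟩
    rwa [Function.update_self, Function.update_of_ne hzu]
  refine hleft v (hc _ (fun a b h => ?_) u v huv)
  have ha : a ≠ u := fun e => hleft b (e ▸ h)
  have hb : b ≠ u := fun e => hleft a (e ▸ h.symm)
  obtain ⟨hab, hcol, hsep⟩ := h
  rw [Function.update_of_ne ha, Function.update_of_ne hb] at hcol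
  rw [Function.update_of_ne ha] at hsep
  refine ⟨hab, hcol, fun z hz => ?_⟩
  by_cases hzu : z = u
  · subst hzu
    by_cases haj : c a = j
    · have hv : v ≠ z := huv.1.ne'
      have h1 := hsep v (by rw [Function.update_of_ne hv, ← huv.2.1]; exact hz)
      have h2 := huv.2.2 a (by rw [haj]; exact hj)
      have h3 := huv.2.2 b (by rw [← hcol, haj]; exact hj)
      rw [G.adj_comm z a, G.adj_comm z b, h2, h3, G.adj_comm a v, G.adj_comm b v]
      exact h1
    · exact hsep z (by rw [Function.update_self]; exact Ne.symm haj)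
  · exact hsep z (by rwa [Function.update_of_ne hzu])

/-- Exchanging the colours of an end `u` of an unseparated edge and of a neighbour `w` of another
colour whose neighbourhood is compatible with that of `u` must create a new unseparated edge. -/
theorem IsMinimalColoring.exists_of_swap {G : SimpleGraph V} {c : V → Fin 3}
    (hc : IsMinimalColoring G c) {u v w : V} (huv : Unseparated G c u v) (hw : c w ≠ c u)
    (huw : G.Adj u w) (hsame : ∀ z, c z ≠ c w → z ≠ u → (G.Adj z u ↔ G.Adj z w))
    (hind : ∀ z, c z = c w → G.Adj u z → ¬ G.Adj w z) :
    ∃ y, c y = c u ∧ G.Adj y u ∧ ∀ z, c z ≠ c u → z ≠ w → (G.Adj z y ↔ G.Adj z w) := by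
  by_contra hno
  set c' : V → Fin 3 := c ∘ Equiv.swap u w with hc'
  have cu : c' u = c w := by simp [hc']
  have cw : c' w = c u := by simp [hc']
  have co : ∀ z, z ≠ u → z ≠ w → c' z = c z := fun z h1 h2 => by
    simp [hc', Equiv.swap_apply_of_ne_of_ne h1 h2]
  have hvu : v ≠ u := huv.1.ne'
  have hvw : v ≠ w := fun e => hw (e ▸ huv.2.1.symm)
  have hleft : ∀ b, ¬ Unseparated G c' u b := by
    rintro b ⟨hab, hcol, hsep⟩
    have hbu : b ≠ u := hab.ne'
    have hbw : b ≠ w := by rintro rfl; rw [cu, cw] at hcol; exact hw hcol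
    rw [cu, co b hbu hbw] at hcol
    have h := (hsep w (by rw [cw, cu]; exact hw.symm)).1 huw.symm
    exact hind b hcol.symm hab h
  have hleft' : ∀ b, ¬ Unseparated G c' w b := by
    rintro b ⟨hab, hcol, hsep⟩
    have hbw : b ≠ w := hab.ne'
    have hbu : b ≠ u := by rintro rfl; rw [cu, cw] at hcol; exact hw hcol.symm
    rw [cw, co b hbu hbw] at hcol
    refine hno ⟨b, hcol.symm, (hsame b (hcol ▸ hw.symm) hbu).2 hab.symm, fun z hz hzw => ?_⟩
    have hzu : z ≠ u := fun e => hz (e ▸ rfl)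
    exact (hsep z (by rw [co z hzu hzw, cw]; exact hz)).symm
  refine hleft v (hc c' (fun a b h => ?_) u v huv)
  have hau : a ≠ u := fun e => hleft b (e ▸ h)
  have hbu : b ≠ u := fun e => hleft a (e ▸ h.symm)
  have haw : a ≠ w := fun e => hleft' b (e ▸ h)
  have hbw : b ≠ w := fun e => hleft' a (e ▸ h.symm)
  obtain ⟨hab, hcol, hsep⟩ := h
  rw [co a hau haw, co b hbu hbw] at hcol
  rw [co a hau haw] at hsep
  refine ⟨hab, hcol, fun z hz => ?_⟩
  by_cases hzu : z = u
  · subst hzu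
    by_cases haj : c w = c a
    · have h1 := hsep v (by rw [co v hvu hvw, ← huv.2.1]; exact hz)
      have h2 := huv.2.2 a (by rw [← haj]; exact hw)
      have h3 := huv.2.2 b (by rw [← hcol, ← haj]; exact hw)
      rw [G.adj_comm z a, G.adj_comm z b, h2, h3, G.adj_comm a v, G.adj_comm b v]
      exact h1
    · exact hsep z (by rw [cu]; exact haj)
  by_cases hzw : z = w
  · subst hzw
    by_cases haj : c u = c a
    · have h1 := hsep u (by rw [cu]; exact hz)
      have h2 := hsame a (by rw [← haj]; exact hw.symm) hau
      have h3 := hsame b (by rw [← hcol, ← haj]; exact hw.symm) hbu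
      rw [G.adj_comm z a, G.adj_comm z b, ← h2, ← h3, G.adj_comm a u, G.adj_comm b u]
      exact h1
    · exact hsep z (by rw [cw]; exact haj)
  · exact hsep z (by rwa [co z hzu hzw])

theorem not_pairwise_adj_of_cliqueFree_five {G : SimpleGraph V} (hG : G.CliqueFree 5)
    {a b c d e : V} (hab : G.Adj a b) (hac : G.Adj a c) (had : G.Adj a d) (hae : G.Adj a e)
    (hbc : G.Adj b c) (hbd : G.Adj b d) (hbe : G.Adj b e) (hcd : G.Adj c d) (hce : G.Adj c e)
    (hde : G.Adj d e) : False := by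
  refine hG {a, b, c, d, e} ?_
  rw [isNClique_iff]
  constructor
  · simp [isClique_iff, Set.Pairwise, hab, hac, had, hae, hbc, hbd, hbe, hcd, hce, hde, hab.symm,
      hac.symm, had.symm, hae.symm, hbc.symm, hbd.symm, hbe.symm, hcd.symm, hce.symm, hde.symm]
  · simp [Finset.card_insert_of_notMem, hab.ne, hac.ne, had.ne, hae.ne, hbc.ne, hbd.ne, hbe.ne,
      hcd.ne, hce.ne, hde.ne]

/-- Let `u v` be an unseparated edge of a minimal colouring of a `K₅`-free graph, let `w` and `x`
obstruct recolouring `u` with either other colour, and let `x'` obstruct recolouring `v` with the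
colour of `x`. Then `v` and `w` have the same neighbours of other colours than `u`, except for `w`
itself, and `w` is the only neighbour of `v` of its colour. -/
theorem IsMinimalColoring.neighbors_of_unseparated {G : SimpleGraph V} (hG : G.CliqueFree 5)
    {c : V → Fin 3} (hc : IsMinimalColoring G c) {u v w x x' : V} (huv : Unseparated G c u v)
    (hw : c w ≠ c u) (hx : c x ≠ c u) (hwx : c w ≠ c x) (hx' : c x' = c x)
    (huw : G.Adj u w) (hux : G.Adj u x) (hvx' : G.Adj v x')
    (hsw : ∀ z, c z ≠ c w → z ≠ u → (G.Adj z u ↔ G.Adj z w))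
    (hsx : ∀ z, c z ≠ c x → z ≠ u → (G.Adj z u ↔ G.Adj z x))
    (hsx' : ∀ z, c z ≠ c x → z ≠ v → (G.Adj z v ↔ G.Adj z x')) :
    (∀ z, c z ≠ c u → z ≠ w → (G.Adj z v ↔ G.Adj z w)) ∧
      ∀ z, c z = c w → G.Adj z v → z = w := by
  have hvw : G.Adj v w := ((huv.2.2 w hw).1 huw.symm).symm
  have hvx : G.Adj v x := ((huv.2.2 x hx).1 hux.symm).symm
  have hxw : G.Adj x w := (hsw x hwx.symm hux.ne').1 hux.symm
  have hind : ∀ z, c z = c w → G.Adj u z → ¬ G.Adj w z := fun z hz huz hwz => by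
    have hzx : G.Adj z x := (hsx z (hz ▸ hwx) huz.ne').1 huz.symm
    have hvz : G.Adj v z := ((huv.2.2 z (hz ▸ hw)).1 huz.symm).symm
    exact not_pairwise_adj_of_cliqueFree_five hG huv.1 huw huz hux hvw hvz hvx hwz hxw.symm hzx
  obtain ⟨y, hyc, hyu, hy⟩ := hc.exists_of_swap huv hw huw hsw hind
  have hyv : y = v := by
    by_contra hne
    have hcx' : c x' ≠ c u := hx' ▸ hx
    have hx'w : x' ≠ w := by rintro rfl; exact hwx hx'
    have hx'u : G.Adj x' u := (huv.2.2 x' hcx').2 hvx'.symm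
    have hx'y : G.Adj x' y := (hy x' hcx' hx'w).2
      ((hsw x' (hx' ▸ hwx.symm) hx'u.ne).1 hx'u)
    have hyv : G.Adj y v := (hsx' y (hyc ▸ hx.symm) hne).2 hx'y.symm
    have hyw : G.Adj y w := (hsw y (hyc ▸ hw.symm) hyu.ne).1 hyu
    have hyx : G.Adj y x := (hsx y (hyc ▸ hx.symm) hyu.ne).1 hyu
    exact not_pairwise_adj_of_cliqueFree_five hG huv.1 hyu.symm huw hux hyv.symm hvw hvx hyw hyx
      hxw.symm
  subst hyv
  refine ⟨hy, fun z hz hzv => ?_⟩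
  by_contra hzw
  have hcz : c z ≠ c u := hz ▸ hw
  exact hind z hz ((huv.2.2 z hcz).2 hzv).symm ((hy z hcz hzw).1 hzv).symm

theorem mem_of_adj_closed {G : SimpleGraph V} (hG : G.Connected) {s : Set V} {a : V}
    (ha : a ∈ s) (hs : ∀ y ∈ s, ∀ z, G.Adj y z → z ∈ s) (b : V) : b ∈ s := by
  obtain ⟨p⟩ := hG.preconnected a b
  induction p with
  | nil => exact ha
  | cons h _ ih => exact ih (hs _ ha _ h)

/-- Minimal colourings of connected `K₅`-free graphs other than `K₄` have no unseparated edge. -/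
theorem IsMinimalColoring.not_unseparated {G : SimpleGraph V} (hconn : G.Connected)
    (hG : G.CliqueFree 5) (hn : 5 ≤ Fintype.card V) {c : V → Fin 3}
    (hc : IsMinimalColoring G c) (u v : V) : ¬ Unseparated G c u v := by
  intro huv
  obtain ⟨j, k, hj, hk, hjk, hall⟩ : ∃ j k : Fin 3, j ≠ c u ∧ k ≠ c u ∧ j ≠ k ∧
      ∀ i, i = c u ∨ i = j ∨ i = k := by
    generalize c u = i
    revert i
    decide
  have hcol := huv.2.1
  obtain ⟨w, hwj, huw, hsw⟩ := hc.exists_of_recolor huv hj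
  obtain ⟨x, hxk, hux, hsx⟩ := hc.exists_of_recolor huv hk
  obtain ⟨w', hwj', hvw', hsw'⟩ := hc.exists_of_recolor huv.symm (hcol ▸ hj)
  obtain ⟨x', hxk', hvx', hsx'⟩ := hc.exists_of_recolor huv.symm (hcol ▸ hk)
  subst hwj hxk
  obtain ⟨hvw_iff, hw_unique⟩ := hc.neighbors_of_unseparated hG huv hj hk hjk hxk' huw hux hvx'
    hsw hsx hsx'
  obtain ⟨hvx_iff, hx_unique⟩ := hc.neighbors_of_unseparated hG huv hk hj hjk.symm hwj' hux huw
    hvw' hsx hsw hsw'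
  obtain rfl : w' = w := hw_unique w' hwj' hvw'.symm
  obtain rfl : x' = x := hx_unique x' hxk' hvx'.symm
  have hwx : G.Adj w' x' := ((hsw x' hjk.symm hux.ne').1 hux.symm).symm
  have hcommon : ∀ z, c z = c u → G.Adj z u → G.Adj z v → False := fun z hz hzu hzv =>
    not_pairwise_adj_of_cliqueFree_five hG huv.1 hzu.symm huw hux hzv.symm hvw' hvx'
      ((hsw z (hz ▸ hj.symm) hzu.ne).1 hzu) ((hsx z (hz ▸ hk.symm) hzu.ne).1 hzu) hwx
  have hu : ∀ z, c z = c u → G.Adj z u → z = v := fun z hz hzu => by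
    by_contra hne
    exact hcommon z hz hzu ((hsw' z (hz ▸ hj.symm) hne).2 ((hsw z (hz ▸ hj.symm) hzu.ne).1 hzu))
  have hv : ∀ z, c z = c u → G.Adj z v → z = u := fun z hz hzv => by
    by_contra hne
    exact hcommon z hz ((hsw z (hz ▸ hj.symm) hne).2 ((hsw' z (hz ▸ hj.symm) hzv.ne).1 hzv)) hzv
  have hNv : ∀ z, G.Adj z v → z ∈ ({u, v, w', x'} : Finset V) := fun z hz => by
    rcases hall (c z) with h | h | h
    · simp [hv z h hz]
    · simp [hw_unique z h hz]
    · simp [hx_unique z h hz]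
  have hclosed : ∀ y ∈ (({u, v, w', x'} : Finset V) : Set V), ∀ z, G.Adj y z →
      z ∈ (({u, v, w', x'} : Finset V) : Set V) := by
    intro y hy z hyz
    simp only [Finset.coe_insert, Finset.coe_singleton, Set.mem_insert_iff,
      Set.mem_singleton_iff] at hy
    rw [Finset.mem_coe]
    by_cases hzv : z = v
    · simp [hzv]
    by_cases hzu : z = u
    · simp [hzu]
    by_cases hzw : z = w'
    · simp [hzw]
    by_cases hzx : z = x'
    · simp [hzx]
    refine hNv z ?_
    by_cases hcz : c z = c u
    · rcases hy with rfl | rfl | rfl | rfl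
      · exact absurd (hu z hcz hyz.symm) hzv
      · exact hyz.symm
      · exact (hsw' z (hcz ▸ hj.symm) hzv).2 hyz.symm
      · exact (hsx' z (hcz ▸ hk.symm) hzv).2 hyz.symm
    · rcases hy with rfl | rfl | rfl | rfl
      · exact (huv.2.2 z hcz).1 hyz.symm
      · exact hyz.symm
      · exact (hvw_iff z hcz hzw).2 hyz.symm
      · exact (hvx_iff z hcz hzx).2 hyz.symm
  have huniv : (Finset.univ : Finset V) ⊆ {u, v, w', x'} := fun b _ =>
    Finset.mem_coe.1 (mem_of_adj_closed hconn (a := u) (by simp) hclosed b)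
  have h4 : ({u, v, w', x'} : Finset V).card ≤ 4 := Finset.card_le_four
  have := (Finset.card_le_card huniv).trans h4
  rw [Finset.card_univ] at this
  omega

theorem isLocalResolving_color_compl {G : SimpleGraph V} {c : V → Fin 3}
    (hc : ∀ u v, ¬ Unseparated G c u v) (i : Fin 3) :
    IsLocalResolving G (Finset.univ.filter fun v => c v ≠ i) := by
  intro u v huv hu hv
  simp only [Finset.mem_filter, Finset.mem_univ, true_and, not_not] at hu hv
  have h := hc u v
  simp only [Unseparated, huv, hu, hv, true_and] at h
  push Not at h
  obtain ⟨z, hz, h⟩ := h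
  refine ⟨z, by simpa using hz, fun hd => ?_⟩
  have key : G.Adj z u ↔ G.Adj z v := by
    rw [G.adj_comm z u, G.adj_comm z v, ← dist_eq_one_iff_adj, ← dist_eq_one_iff_adj, hd]
  tauto

theorem dimL_le_two_thirds (G : SimpleGraph V) (hc : G.Connected)
    (hn : 5 ≤ Fintype.card V) (hω : G.cliqueNum = 4) :
    (dimL G : ℤ) ≤ ⌊(2 / 3 : ℚ) * (Fintype.card V : ℚ)⌋ := by
  have hfree : G.CliqueFree 5 := fun s hs => by
    have := hs.card_eq ▸ hs.isClique.card_le_cliqueNum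
    omega
  obtain ⟨c, hmin⟩ := exists_isMinimalColoring G
  have hsep := hmin.not_unseparated hc hfree hn
  obtain ⟨i, hi⟩ : ∃ i, 3 * (Finset.univ.filter fun v => c v ≠ i).card ≤ 2 * Fintype.card V := by
    by_contra! h
    have hcompl : ∀ i, (Finset.univ.filter fun v => c v = i).card +
        (Finset.univ.filter fun v => c v ≠ i).card = Fintype.card V := fun i =>
      Finset.card_filter_add_card_filter_not _
    have hsum := Finset.card_eq_sum_card_fiberwise (s := (Finset.univ : Finset V)) (f := c)
      (t := Finset.univ) (by simp)
    rw [Fin.sum_univ_three, Finset.card_univ] at hsum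
    have := h 0; have := h 1; have := h 2
    have := hcompl 0; have := hcompl 1; have := hcompl 2
    omega
  have hdim : dimL G ≤ (Finset.univ.filter fun v => c v ≠ i).card :=
    Nat.sInf_le ⟨_, rfl, isLocalResolving_color_compl hsep i⟩
  rw [Int.le_floor]
  have h : (3 * dimL G : ℚ) ≤ 2 * Fintype.card V := by exact_mod_cast (by omega)
  push_cast
  linarith
end
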